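/- arXiv:2006.01176 — 3 statements merged into one kernel-verified Lean document; each statement's English description precedes it below -/
import Mathlib

section
/- Let R be a commutative ring and (A, D_G) a 1-tilting cotorsion pair with associated Gabriel topology G. If A is a covering class, then p.dim R_G ≤ 1; in particular, R_G ⊕ R_G/R is a 1-tilting module associated to the cotorsion pair (A, D_G), and Gen(R_G) = D_G (every G-divisible module is an epimorphic image of a direct sum of copies of R_G, and conversely). -/
universe u

/-- A Gabriel topology on a commutative ring `R`: a filter of ideals of `R`
satisfying the Gabriel axiom T4. -/
structure GabrielTopology (R : Type u) [CommRing R] : Type u where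
  sets : Set (Ideal R)
  top_mem : (⊤ : Ideal R) ∈ sets
  mem_of_le : ∀ {I J : Ideal R}, I ∈ sets → I ≤ J → J ∈ sets
  inf_mem : ∀ {I J : Ideal R}, I ∈ sets → J ∈ sets → I ⊓ J ∈ sets
  gabriel : ∀ I J : Ideal R, J ∈ sets →
    (∀ r ∈ J, Submodule.colon I (Ideal.span {r}) ∈ sets) → I ∈ sets

namespace GabrielTopology

variable {R : Type u} [CommRing R] (G : GabrielTopology R)

/-- A module `M` is `G`-torsion if the annihilator of every element belongs to `G`. -/
def IsTorsion (M : Type u) [AddCommGroup M] [Module R M] : Prop :=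
  ∀ x : M, Ideal.torsionOf R M x ∈ G.sets

/-- A module `M` is `G`-torsion-free if no nonzero element is annihilated by an ideal of `G`. -/
def IsTorsionFree (M : Type u) [AddCommGroup M] [Module R M] : Prop :=
  ∀ x : M, Ideal.torsionOf R M x ∈ G.sets → x = 0

/-- A module `M` is `G`-divisible if `JM = M` for every `J ∈ G`. -/
def IsDivisible (M : Type u) [AddCommGroup M] [Module R M] : Prop :=
  ∀ J ∈ G.sets, J • (⊤ : Submodule R M) = ⊤

/-- `G` is faithful if `R` is `G`-torsion-free. -/
def Faithful : Prop := ∀ r : R, Ideal.torsionOf R R r ∈ G.sets → r = 0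

/-- `G` is finitely generated if it has a basis of finitely generated ideals. -/
def FinitelyGenerated : Prop := ∀ J ∈ G.sets, ∃ J' ∈ G.sets, J' ≤ J ∧ J'.FG

end GabrielTopology

/-- `Ext¹_R(M, N) = 0`, expressed by the standard characterisation:
every short exact sequence `0 → N → E → M → 0` splits. -/
def Ext1Vanish (R : Type u) [CommRing R] (M N : Type u) [AddCommGroup M] [Module R M]
    [AddCommGroup N] [Module R N] : Prop :=
  ∀ (E : Type u) [AddCommGroup E] [Module R E] (i : N →ₗ[R] E) (p : E →ₗ[R] M),
    Function.Injective i → Function.Surjective p → LinearMap.range i = LinearMap.ker p →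
      ∃ s : M →ₗ[R] E, p ∘ₗ s = LinearMap.id

/-- `M` has projective dimension at most 1: the kernel of a free cover is projective. -/
def ProjDimLE1 (R : Type u) [CommRing R] (M : Type u) [AddCommGroup M] [Module R M] : Prop :=
  ∃ (ι : Type u) (p : (ι →₀ R) →ₗ[R] M),
    Function.Surjective p ∧ Module.Projective R ↥(LinearMap.ker p)

/-- `M ∈ Add(T)`: `M` is a direct summand of a direct sum of copies of `T`. -/
def InAdd (R : Type u) [CommRing R] (T M : Type u) [AddCommGroup T] [Module R T]
    [AddCommGroup M] [Module R M] : Prop :=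
  ∃ (ι : Type u) (s : M →ₗ[R] (ι →₀ T)) (r : (ι →₀ T) →ₗ[R] M), r ∘ₗ s = LinearMap.id

/-- `T` is a 1-tilting module: (T1) `p.dim T ≤ 1`, (T2) `Ext¹(T, T^(κ)) = 0` for all κ,
(T3) there is an exact sequence `0 → R → T₀ → T₁ → 0` with `T₀, T₁ ∈ Add(T)`. -/
def Is1Tilting (R : Type u) [CommRing R] (T : Type u) [AddCommGroup T] [Module R T] : Prop :=
  ProjDimLE1 R T ∧
  (∀ ι : Type u, Ext1Vanish R T (ι →₀ T)) ∧
  ∃ (T0 T1 : ModuleCat.{u} R) (i : R →ₗ[R] ↥T0) (p : ↥T0 →ₗ[R] ↥T1),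
    InAdd R T ↥T0 ∧ InAdd R T ↥T1 ∧
    Function.Injective i ∧ Function.Surjective p ∧ LinearMap.range i = LinearMap.ker p

namespace GabrielTopology

variable {R : Type u} [CommRing R] (G : GabrielTopology R)

/-- `(𝒜, 𝒟_G)` is a 1-tilting cotorsion pair with associated Gabriel topology `G`:
`G` is a faithful finitely generated Gabriel topology and the class of `G`-divisible
modules is the tilting class of a 1-tilting module. -/
def IsTiltingTopology : Prop :=
  G.Faithful ∧ G.FinitelyGenerated ∧
  ∃ T : ModuleCat.{u} R, Is1Tilting R ↥T ∧
    ∀ (M : Type u) [AddCommGroup M] [Module R M], (Ext1Vanish R ↥T M ↔ G.IsDivisible M)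

/-- Membership in the left-hand class `𝒜 = ᗮ(𝒟_G)` of the 1-tilting cotorsion pair. -/
def MemA (M : Type u) [AddCommGroup M] [Module R M] : Prop :=
  ∀ (D : Type u) [AddCommGroup D] [Module R D], G.IsDivisible D → Ext1Vanish R M D

/-- The class `𝒜` is covering: every module has an `𝒜`-cover. -/
def IsACovering : Prop :=
  ∀ (M : Type u) [AddCommGroup M] [Module R M],
    ∃ (C : ModuleCat.{u} R) (φ : ↥C →ₗ[R] M),
      G.MemA ↥C ∧
      (∀ (C' : Type u) [AddCommGroup C'] [Module R C'], G.MemA C' →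
        ∀ f : C' →ₗ[R] M, ∃ g : C' →ₗ[R] ↥C, φ ∘ₗ g = f) ∧
      (∀ e : ↥C →ₗ[R] ↥C, φ ∘ₗ e = φ → Function.Bijective e)

/-- The class `𝒜` is closed under direct limits. -/
def AClosedUnderDirectLimits : Prop :=
  ∀ (ι : Type u) [Preorder ι] [IsDirected ι (· ≤ ·)] [Nonempty ι] [DecidableEq ι]
    (M : ι → Type u) [∀ i, AddCommGroup (M i)] [∀ i, Module R (M i)]
    (f : ∀ i j, i ≤ j → M i →ₗ[R] M j) [DirectedSystem M fun i j h => f i j h],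
    (∀ i, G.MemA (M i)) → G.MemA (Module.DirectLimit M f)

/-- `Q`, via `algebraMap R Q`, is the ring of quotients `R_G` of `R` with respect to `G`:
`Q` is `G`-torsion-free and `G`-injective (i.e. `G`-closed) and the kernel and cokernel
of `R → Q` are `G`-torsion. -/
structure IsRingOfQuotients (Q : Type u) [CommRing Q] [Algebra R Q] : Prop where
  torsionFree : ∀ q : Q, Ideal.torsionOf R Q q ∈ G.sets → q = 0
  gInjective : ∀ J ∈ G.sets, ∀ f : ↥J →ₗ[R] Q, ∃ q : Q, ∀ j : ↥J, f j = (j : R) • q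
  ker_torsion : ∀ r : R, algebraMap R Q r = 0 → Ideal.torsionOf R R r ∈ G.sets
  coker_torsion : ∀ q : Q, ∃ J ∈ G.sets, ∀ x ∈ J, ∃ r : R, x • q = algebraMap R Q r

/-- `G` is a perfect Gabriel topology, realised by the perfect localisation `Q`:
`R → Q` is a flat ring epimorphism and `G = {J ∣ JQ = Q}`. -/
def IsPerfectLocalization (Q : Type u) [CommRing Q] [Algebra R Q] : Prop :=
  Module.Flat R Q ∧
  (∀ (S : Type u) [CommRing S] (f g : Q →+* S),
    f.comp (algebraMap R Q) = g.comp (algebraMap R Q) → f = g) ∧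
  (∀ J : Ideal R, J ∈ G.sets ↔ J • (⊤ : Submodule R Q) = ⊤)

end GabrielTopology

/-- A commutative ring is perfect iff every flat module is projective. -/
def IsPerfectRing (S : Type u) [CommRing S] : Prop :=
  ∀ (M : Type u) [AddCommGroup M] [Module S M], Module.Flat S M → Module.Projective S M

/-- `X` is Σ-pure-split: every pure embedding `A ⊆ B` with `B ∈ Add(X)` splits. -/
def SigmaPureSplit (R : Type u) [CommRing R] (X : Type u) [AddCommGroup X] [Module R X] : Prop :=
  ∀ (A B : Type u) [AddCommGroup A] [Module R A] [AddCommGroup B] [Module R B] (i : A →ₗ[R] B),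
    Function.Injective i →
    (∀ (M : Type u) [AddCommGroup M] [Module R M], Function.Injective (LinearMap.rTensor M i)) →
    InAdd R X B → ∃ r : B →ₗ[R] A, r ∘ₗ i = LinearMap.id

/-- A concrete model of `Ext¹_R(M, N)`, computed from the canonical free presentation
`0 → S → (M →₀ R) → M → 0` of `M` as `coker (Hom((M →₀ R), N) → Hom(S, N))`. -/
abbrev ext1 (R : Type u) [CommRing R] (M N : Type u) [AddCommGroup M] [Module R M]
    [AddCommGroup N] [Module R N] : Type u :=
  (↥(LinearMap.ker (Finsupp.linearCombination R (id : M → M))) →ₗ[R] N) ⧸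
    LinearMap.range
      (LinearMap.lcomp R N (LinearMap.ker (Finsupp.linearCombination R (id : M → M))).subtype)

/-- A concrete model of `Tor₁^R(M, N)`, computed from the canonical free presentation
`0 → S → (M →₀ R) → M → 0` of `M` as `ker (S ⊗ N → (M →₀ R) ⊗ N)`. -/
abbrev tor1 (R : Type u) [CommRing R] (M N : Type u) [AddCommGroup M] [Module R M]
    [AddCommGroup N] [Module R N] : Type u :=
  ↥(LinearMap.ker
    (LinearMap.rTensor N (LinearMap.ker (Finsupp.linearCombination R (id : M → M))).subtype))

/-- The cokernel `U/R` of a ring map `R → U`. -/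
abbrev cokerAlg (R U : Type u) [CommRing R] [CommRing U] [Algebra R U] : Type u :=
  U ⧸ LinearMap.range (Algebra.linearMap R U)

/-- A linear topology on a commutative ring `R`, given by its filter of open ideals. -/
structure LinearTopologyOn (R : Type u) [CommRing R] : Type u where
  sets : Set (Ideal R)
  top_mem : (⊤ : Ideal R) ∈ sets
  mem_of_le : ∀ {I J : Ideal R}, I ∈ sets → I ≤ J → J ∈ sets
  inf_mem : ∀ {I J : Ideal R}, I ∈ sets → J ∈ sets → I ⊓ J ∈ sets

/-- An `R`-module `M` is `H`-discrete if the annihilator of every element is open. -/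
def LinearTopologyOn.IsDiscrete {R : Type u} [CommRing R] (H : LinearTopologyOn R)
    (M : Type u) [AddCommGroup M] [Module R M] : Prop :=
  ∀ x : M, Ideal.torsionOf R M x ∈ H.sets

/-- `R` is `H`-h-local: every open ideal is contained in only finitely many maximal ideals,
and every open prime ideal is contained in only one maximal ideal. -/
def LinearTopologyOn.IsHLocal {R : Type u} [CommRing R] (H : LinearTopologyOn R) : Prop :=
  (∀ J ∈ H.sets, {m : Ideal R | m.IsMaximal ∧ J ≤ m}.Finite) ∧
  (∀ p ∈ H.sets, p.IsPrime →
    ∀ m n : Ideal R, m.IsMaximal → n.IsMaximal → p ≤ m → p ≤ n → m = n)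

/-- Over `S`, `M` admits a resolution of length `n` by finitely generated projectives. -/
def FGProjDimLE (S : Type u) [CommRing S] :
    ℕ → ∀ (M : Type u) [AddCommGroup M] [Module S M], Prop
  | 0, M, iA, iM =>
      letI := iA; letI := iM
      Module.Finite S M ∧ Module.Projective S M
  | n + 1, M, iA, iM =>
      letI := iA; letI := iM
      ∃ (k : ℕ) (f : (Fin k → S) →ₗ[S] M),
        Function.Surjective f ∧ FGProjDimLE S n ↥(LinearMap.ker f)

/-- A linear map out of `A` factors through any surjection from `A` with smaller kernel. -/
lemma LinearMap.exists_factor_of_surjective {R A B C : Type*} [Ring R] [AddCommGroup A] [Module R A]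
    [AddCommGroup B] [Module R B] [AddCommGroup C] [Module R C] (g : A →ₗ[R] B)
    (hg : Function.Surjective g) (h : A →ₗ[R] C) (hk : ∀ a, g a = 0 → h a = 0) :
    ∃ f : B →ₗ[R] C, ∀ a, f (g a) = h a := by
  refine ⟨(LinearMap.ker g).liftQ h (fun a ha => hk a ha) ∘ₗ
    (g.quotKerEquivOfSurjective hg).symm.toLinearMap, fun a => ?_⟩
  have : (g.quotKerEquivOfSurjective hg).symm (g a) = (LinearMap.ker g).mkQ a := by
    rw [LinearEquiv.symm_apply_eq]; rfl
  rw [LinearMap.comp_apply, LinearEquiv.coe_coe, this]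
  exact Submodule.liftQ_apply _ h a

/-- Every module embeds into an injective module of the same universe. -/
lemma Module.exists_injective_embedding (R : Type u) [CommRing R] (N : Type u) [AddCommGroup N]
    [Module R N] : ∃ (E : ModuleCat.{u} R) (i : N →ₗ[R] E),
      Module.Injective R E ∧ Function.Injective i := by
  let X : ModuleCat.{u} R := ModuleCat.of R N
  let I : ModuleCat.{u} R := CategoryTheory.Injective.under X
  have hI : CategoryTheory.Injective I :=
    inferInstanceAs (CategoryTheory.Injective (CategoryTheory.Injective.under X))
  refine ⟨I, (CategoryTheory.Injective.ι X).hom,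
    @Module.injective_module_of_injective_object R I _ _ _ hI, ?_⟩
  exact (ModuleCat.mono_iff_injective _).1 inferInstance

namespace Ext1Vanish

variable {R : Type u} [CommRing R] {M D F X Y : Type u} [AddCommGroup M] [Module R M]
  [AddCommGroup D] [Module R D] [AddCommGroup F] [Module R F] [AddCommGroup X] [Module R X]
  [AddCommGroup Y] [Module R Y]

/-- Maps out of `M` lift along epimorphisms with kernel `D` when `Ext¹(M, D) = 0`. -/
lemma exists_lift (h : Ext1Vanish R M D) (i : D →ₗ[R] Y) (p : Y →ₗ[R] X)
    (hi : Function.Injective i) (hp : Function.Surjective p)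
    (hip : LinearMap.range i = LinearMap.ker p) (f : M →ₗ[R] X) :
    ∃ g : M →ₗ[R] Y, ∀ m, p (g m) = f m := by
  let P : Submodule R (M × Y) := LinearMap.ker (f ∘ₗ LinearMap.fst R M Y - p ∘ₗ LinearMap.snd R M Y)
  have memP : ∀ z : M × Y, z ∈ P ↔ f z.1 = p z.2 := fun z => by
    simp [P, sub_eq_zero]
  have hpi : ∀ d, p (i d) = 0 := fun d => by
    have : i d ∈ LinearMap.ker p := hip ▸ LinearMap.mem_range_self i d
    exact this
  let j : D →ₗ[R] P := LinearMap.codRestrict P (LinearMap.inr R M Y ∘ₗ i) fun d => by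
    rw [memP]; simp [hpi]
  obtain ⟨s, hs⟩ := h P j (LinearMap.fst R M Y ∘ₗ P.subtype)
    (fun a b hab => hi (congrArg (fun z : P => z.1.2) hab))
    (fun m => by
      obtain ⟨y, hy⟩ := hp (f m)
      exact ⟨⟨(m, y), (memP _).2 hy.symm⟩, rfl⟩)
    (by
      ext z
      constructor
      · rintro ⟨d, rfl⟩
        rfl
      · intro hz
        have hz1 : z.1.1 = 0 := hz
        have hz2 : p z.1.2 = 0 := by
          have := (memP z.1).1 z.2
          rw [← this, hz1, map_zero]
        have : z.1.2 ∈ LinearMap.range i := by rw [hip]; exact hz2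
        obtain ⟨d, hd⟩ := this
        exact ⟨d, Subtype.ext (Prod.ext hz1.symm hd)⟩)
  refine ⟨LinearMap.snd R M Y ∘ₗ P.subtype ∘ₗ s, fun m => ?_⟩
  have h1 := (memP (s m).1).1 (s m).2
  have h2 : (s m).1.1 = m := LinearMap.congr_fun hs m
  rw [h2] at h1
  exact h1.symm

/-- Maps into `D` extend from the kernel of an epimorphism onto `M` when `Ext¹(M, D) = 0`. -/
lemma exists_extend (h : Ext1Vanish R M D) (p : F →ₗ[R] M) (hp : Function.Surjective p)
    (k : LinearMap.ker p →ₗ[R] D) : ∃ g : F →ₗ[R] D, ∀ x : LinearMap.ker p, g x = k x := by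
  obtain ⟨E, i, hE, hi⟩ := Module.exists_injective_embedding R D
  obtain ⟨e, he⟩ := hE.out (LinearMap.ker p).subtype Subtype.val_injective (i ∘ₗ k)
  obtain ⟨f, hf⟩ := LinearMap.exists_factor_of_surjective p hp ((LinearMap.range i).mkQ ∘ₗ e)
    (fun a ha => by
      have := he ⟨a, ha⟩
      simp only [Submodule.subtype_apply] at this
      simp [this])
  obtain ⟨g, hg⟩ := h.exists_lift i (LinearMap.range i).mkQ hi (Submodule.mkQ_surjective _)
    (by simp) f
  have hr : ∀ a, (e - g ∘ₗ p) a ∈ LinearMap.range i := fun a => by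
    rw [← Submodule.ker_mkQ (LinearMap.range i), LinearMap.mem_ker]
    simp only [LinearMap.sub_apply, LinearMap.comp_apply, map_sub, hg, hf, sub_self]
  refine ⟨(LinearEquiv.ofInjective i hi).symm.toLinearMap ∘ₗ
    LinearMap.codRestrict (LinearMap.range i) (e - g ∘ₗ p) hr, fun x => ?_⟩
  simp only [LinearMap.comp_apply, LinearEquiv.coe_coe]
  rw [LinearEquiv.symm_apply_eq]
  ext
  have h1 := he x
  have h2 : p x = 0 := x.2
  simp only [Submodule.subtype_apply] at h1
  simp [h1, h2]

end Ext1Vanish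

namespace GabrielTopology

variable {R : Type u} [CommRing R] {G : GabrielTopology R}

lemma mul_mem {I J : Ideal R} (hI : I ∈ G.sets) (hJ : J ∈ G.sets) : I * J ∈ G.sets := by
  refine G.gabriel _ J hJ fun r hr => G.mem_of_le hI fun a ha => ?_
  rw [Ideal.mem_colon_span_singleton]
  exact Ideal.mul_mem_mul ha hr

lemma pow_mem {I : Ideal R} (hI : I ∈ G.sets) (n : ℕ) : I ^ n ∈ G.sets := by
  induction n with
  | zero => simpa using G.top_mem
  | succ n ih => rw [pow_succ]; exact mul_mem ih hI

lemma FinitelyGenerated.exists_fin (hfg : G.FinitelyGenerated) {J : Ideal R} (hJ : J ∈ G.sets) :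
    ∃ (m : ℕ) (x : Fin m → R), (∀ i, x i ∈ J) ∧ Ideal.span (Set.range x) ∈ G.sets := by
  obtain ⟨J', hJ', hle, hJfg⟩ := hfg J hJ
  obtain ⟨m, x, rfl⟩ := Submodule.fg_iff_exists_fin_generating_family.1 hJfg
  exact ⟨m, x, fun i => hle (Submodule.subset_span ⟨i, rfl⟩), hJ'⟩

/-- An ideal outside a finitely generated Gabriel topology lies in a prime outside it. -/
lemma FinitelyGenerated.exists_prime (hfg : G.FinitelyGenerated) {J : Ideal R}
    (hJ : J ∉ G.sets) : ∃ p : Ideal R, p.IsPrime ∧ J ≤ p ∧ p ∉ G.sets := by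
  obtain ⟨p, hle, hp⟩ := zorn_le_nonempty₀ {I : Ideal R | I ∉ G.sets} (fun c hc hch y hy => by
    refine ⟨sSup c, fun hs => ?_, fun z hz => le_sSup hz⟩
    obtain ⟨J', hJ', hle, hfgJ⟩ := hfg _ hs
    have := (CompleteLattice.isCompactElement_iff_le_of_directed_sSup_le _ _).1
      ((Submodule.fg_iff_compact J').1 hfgJ) c ⟨y, hy⟩ hch.directedOn hle
    obtain ⟨z, hz, hz'⟩ := this
    exact hc hz (G.mem_of_le hJ' hz')) J hJ
  have hmax : ∀ a, a ∉ p → p ⊔ Ideal.span {a} ∈ G.sets := fun a ha => by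
    by_contra hcon
    exact ha (hp.le_of_ge hcon le_sup_left
      (Submodule.mem_sup_right (Ideal.mem_span_singleton_self a)))
  refine ⟨p, ⟨?_, ?_⟩, hle, hp.prop⟩
  · rintro rfl
    exact hp.prop G.top_mem
  · intro a b hab
    by_contra! hcon
    refine hp.prop (G.mem_of_le (mul_mem (hmax a hcon.1) (hmax b hcon.2)) ?_)
    rw [Ideal.sup_mul, Ideal.mul_sup, Ideal.mul_sup, Ideal.span_singleton_mul_span_singleton]
    refine sup_le (sup_le Ideal.mul_le_left Ideal.mul_le_left) (sup_le Ideal.mul_le_right ?_)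
    rwa [Ideal.span_singleton_le_iff_mem]

lemma torsionOf_mem {N : Type u} [AddCommGroup N] [Module R N] {J : Ideal R} (hJ : J ∈ G.sets)
    {n : N} (h : ∀ r ∈ J, r • n = 0) : Ideal.torsionOf R N n ∈ G.sets :=
  G.mem_of_le hJ h

lemma torsionOf_mem_of_range {N : Type u} [AddCommGroup N] [Module R N] {m : ℕ} {x : Fin m → R}
    (hx : Ideal.span (Set.range x) ∈ G.sets) {n : N} (h : ∀ i, x i • n = 0) :
    Ideal.torsionOf R N n ∈ G.sets := by
  refine G.mem_of_le hx (Ideal.span_le.2 ?_)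
  rintro _ ⟨i, rfl⟩
  exact h i

section Divisible

variable {N N' : Type u} [AddCommGroup N] [Module R N] [AddCommGroup N'] [Module R N']

lemma IsDivisible.exists_sum (h : G.IsDivisible N) {m : ℕ} {x : Fin m → R}
    (hx : Ideal.span (Set.range x) ∈ G.sets) (d : N) : ∃ c : Fin m → N, d = ∑ i, x i • c i := by
  have hd : d ∈ Ideal.span (Set.range x) • (⊤ : Submodule R N) := by rw [h _ hx]; trivial
  have hle : Ideal.span (Set.range x) • (⊤ : Submodule R N) ≤
      LinearMap.range (∑ i, x i • LinearMap.proj (R := R) (φ := fun _ : Fin m => N) i) := by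
    rw [Submodule.smul_le]
    intro r hr n _
    obtain ⟨c, rfl⟩ := Ideal.mem_span_range_iff_exists_fun.1 hr
    exact ⟨fun i => c i • n, by simp [Finset.sum_smul, smul_smul, mul_comm]⟩
  obtain ⟨c, rfl⟩ := hle hd
  exact ⟨c, by simp⟩

lemma FinitelyGenerated.isDivisible (hfg : G.FinitelyGenerated)
    (h : ∀ (m : ℕ) (x : Fin m → R), Ideal.span (Set.range x) ∈ G.sets →
      ∀ d : N, ∃ c : Fin m → N, d = ∑ i, x i • c i) : G.IsDivisible N := by
  intro J hJ
  obtain ⟨m, x, hxJ, hx⟩ := hfg.exists_fin hJ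
  rw [eq_top_iff]
  rintro d -
  obtain ⟨c, rfl⟩ := h m x hx d
  exact Submodule.sum_mem _ fun i _ => Submodule.smul_mem_smul (hxJ i) trivial

lemma IsDivisible.map_mem (h : G.IsDivisible N) (f : N →ₗ[R] N') (n : N) {J : Ideal R}
    (hJ : J ∈ G.sets) : f n ∈ J • (⊤ : Submodule R N') := by
  have : n ∈ J • (⊤ : Submodule R N) := by rw [h J hJ]; trivial
  have := Submodule.mem_map_of_mem (f := f) this
  rw [Submodule.map_smul''] at this
  exact Submodule.smul_mono le_rfl le_top this

lemma IsDivisible.of_surjective (h : G.IsDivisible N) (f : N →ₗ[R] N')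
    (hf : Function.Surjective f) : G.IsDivisible N' := by
  intro J hJ
  rw [eq_top_iff]
  rintro d -
  obtain ⟨n, rfl⟩ := hf d
  exact h.map_mem f n hJ

lemma IsDivisible.of_linearEquiv (h : G.IsDivisible N) (e : N ≃ₗ[R] N') : G.IsDivisible N' :=
  h.of_surjective e.toLinearMap e.surjective

lemma IsDivisible.finsupp (h : G.IsDivisible N) (ι : Type u) : G.IsDivisible (ι →₀ N) := by
  intro J hJ
  rw [eq_top_iff]
  rintro d -
  induction d using Finsupp.induction_linear with
  | zero => exact zero_mem _
  | add f g hf hg => exact add_mem hf hg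
  | single i n => exact h.map_mem (Finsupp.lsingle i) n hJ

lemma IsDivisible.dfinsupp {κ : Type*} [DecidableEq κ] {P : κ → Type u} [∀ n, AddCommGroup (P n)]
    [∀ n, Module R (P n)] (h : ∀ n, G.IsDivisible (P n)) {J : Ideal R} (hJ : J ∈ G.sets) :
    J • (⊤ : Submodule R (Π₀ n, P n)) = ⊤ := by
  rw [eq_top_iff]
  rintro d -
  induction d using DFinsupp.induction with
  | h0 => exact zero_mem _
  | ha i n f _ _ hf =>
    refine add_mem (Submodule.smul_mono le_rfl le_top
      (?_ : _ ∈ J • LinearMap.range (DFinsupp.lsingle (R := R) (M := P) i))) hf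
    have : n ∈ J • (⊤ : Submodule R (P i)) := by rw [h i J hJ]; trivial
    have := Submodule.mem_map_of_mem (f := DFinsupp.lsingle (R := R) (M := P) i) this
    rwa [Submodule.map_smul'', Submodule.map_top] at this

lemma IsDivisible.prod (h : G.IsDivisible N) (h' : G.IsDivisible N') : G.IsDivisible (N × N') := by
  intro J hJ
  rw [eq_top_iff]
  rintro ⟨a, b⟩ -
  rw [← add_zero a, ← zero_add b, ← Prod.mk_add_mk]
  exact add_mem (h.map_mem (LinearMap.inl R N N') a hJ) (h'.map_mem (LinearMap.inr R N N') b hJ)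

/-- Injective modules are divisible with respect to a faithful topology. -/
lemma isDivisible_of_injective (hf : G.Faithful) (hfg : G.FinitelyGenerated)
    (hN : Module.Injective R N) : G.IsDivisible N := by
  refine hfg.isDivisible fun m x hx d => ?_
  obtain ⟨e, he⟩ := hN.out (X := R) (Y := Fin m → R)
    (LinearMap.pi fun i => x i • LinearMap.id)
    (by
      rw [injective_iff_map_eq_zero]
      intro r hr
      refine hf r (torsionOf_mem_of_range hx fun i => ?_)
      simpa using congrFun hr i)
    (LinearMap.toSpanSingleton R N d)
  refine ⟨fun i => e (Pi.single i 1), ?_⟩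
  have h1 := he 1
  rw [LinearMap.toSpanSingleton_apply, one_smul] at h1
  rw [← h1]
  simp only [← map_smul, ← map_sum]
  congr 1
  ext j
  simp [Finset.sum_apply, Pi.single_apply]

lemma isDivisible_atPrime {p : Ideal R} [p.IsPrime] (hp : p ∉ G.sets) :
    G.IsDivisible (Localization.AtPrime p) := by
  intro J hJ
  have : ¬ J ≤ p := fun hle => hp (G.mem_of_le hJ hle)
  obtain ⟨y, hyJ, hy⟩ := SetLike.not_le_iff_exists.1 this
  rw [eq_top_iff]
  rintro d -
  have hu : IsUnit (algebraMap R (Localization.AtPrime p) y) :=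
    IsLocalization.map_units (Localization.AtPrime p) (⟨y, hy⟩ : p.primeCompl)
  obtain ⟨v, hv⟩ := hu.exists_left_inv
  have : d = y • (v * d) := by
    rw [Algebra.smul_def, ← mul_assoc, mul_comm _ v, hv, one_mul]
  rw [this]
  exact Submodule.smul_mem_smul hyJ trivial

end Divisible

end GabrielTopology

namespace GabrielTopology

variable {R : Type u} [CommRing R] {G : GabrielTopology R}

section MemA

variable {M M' X Y : Type u} [AddCommGroup M] [Module R M] [AddCommGroup M'] [Module R M']
  [AddCommGroup X] [Module R X] [AddCommGroup Y] [Module R Y]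

lemma MemA.exists_lift (hM : G.MemA M) (p : Y →ₗ[R] X) (hp : Function.Surjective p)
    (hk : G.IsDivisible (LinearMap.ker p)) (f : M →ₗ[R] X) :
    ∃ g : M →ₗ[R] Y, ∀ m, p (g m) = f m :=
  (hM _ hk).exists_lift (LinearMap.ker p).subtype p Subtype.val_injective hp (by simp) f

lemma memA_of_exists_section
    (h : ∀ (Y : Type u) [AddCommGroup Y] [Module R Y] (p : Y →ₗ[R] M), Function.Surjective p →
      G.IsDivisible (LinearMap.ker p) → ∃ s : M →ₗ[R] Y, ∀ m, p (s m) = m) : G.MemA M := by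
  intro D _ _ hD E _ _ i p hi hp hip
  obtain ⟨s, hs⟩ := h E p hp
    (hD.of_linearEquiv ((LinearEquiv.ofInjective i hi).trans (LinearEquiv.ofEq _ _ hip)))
  exact ⟨s, LinearMap.ext hs⟩

lemma MemA.of_retract (hM : G.MemA M) (s : M' →ₗ[R] M) (r : M →ₗ[R] M')
    (hrs : ∀ m, r (s m) = m) : G.MemA M' := by
  refine memA_of_exists_section fun Y _ _ p hp hk => ?_
  obtain ⟨g, hg⟩ := hM.exists_lift p hp hk r
  exact ⟨g ∘ₗ s, fun m => by simp [hg, hrs]⟩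

lemma MemA.prod (hM : G.MemA M) (hM' : G.MemA M') : G.MemA (M × M') := by
  refine memA_of_exists_section fun Y _ _ p hp hk => ?_
  obtain ⟨g, hg⟩ := hM.exists_lift p hp hk (LinearMap.inl R M M')
  obtain ⟨g', hg'⟩ := hM'.exists_lift p hp hk (LinearMap.inr R M M')
  exact ⟨g.coprod g', fun m => by simp [hg, hg']⟩

lemma memA_of_projective [Module.Projective R M] : G.MemA M := by
  refine memA_of_exists_section fun Y _ _ p hp _ => ?_
  obtain ⟨s, hs⟩ := Module.projective_lifting_property p LinearMap.id hp
  exact ⟨s, LinearMap.congr_fun hs⟩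

/-- Modules in the left-hand class have projective dimension at most one. -/
lemma MemA.projDimLE1 (hf : G.Faithful) (hfg : G.FinitelyGenerated) (hM : G.MemA M) :
    ProjDimLE1 R M := by
  refine ⟨M, Finsupp.linearCombination R id, Finsupp.linearCombination_surjective R
    Function.surjective_id, ?_⟩
  set p : (M →₀ R) →ₗ[R] M := Finsupp.linearCombination R id
  have hp : Function.Surjective p := Finsupp.linearCombination_surjective R Function.surjective_id
  refine Module.Projective.of_lifting_property'' fun q hq => ?_
  obtain ⟨E, i, hE, hi⟩ := Module.exists_injective_embedding R (LinearMap.ker p →₀ R)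
  have hEd : G.IsDivisible E := isDivisible_of_injective hf hfg hE
  let S : Submodule R E := (LinearMap.ker q).map i
  obtain ⟨u, hu⟩ := LinearMap.exists_factor_of_surjective (R := R)
      (A := LinearMap.ker p →₀ R) (B := LinearMap.ker p) q hq (S.mkQ ∘ₗ i) fun a ha => by
    simp only [LinearMap.comp_apply, Submodule.mkQ_apply, Submodule.Quotient.mk_eq_zero]
    exact ⟨a, ha, rfl⟩
  obtain ⟨v, hv⟩ := (hM (E ⧸ S)
    (hEd.of_surjective S.mkQ S.mkQ_surjective)).exists_extend p hp u
  obtain ⟨w, hw⟩ := Module.projective_lifting_property S.mkQ v S.mkQ_surjective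
  have hrange : ∀ k : LinearMap.ker p, w k ∈ LinearMap.range i := fun k => by
    obtain ⟨a, rfl⟩ := hq k
    have h1 : S.mkQ (w (q a)) = S.mkQ (i a) := by
      rw [← LinearMap.comp_apply, hw, hv, hu, LinearMap.comp_apply]
    rw [← sub_eq_zero, ← map_sub, Submodule.mkQ_apply, Submodule.Quotient.mk_eq_zero] at h1
    obtain ⟨b, -, hb⟩ := h1
    exact ⟨b + a, by rw [map_add, hb, sub_add_cancel]⟩
  refine ⟨(LinearEquiv.ofInjective i hi).symm.toLinearMap ∘ₗ
    LinearMap.codRestrict (LinearMap.range i) (w ∘ₗ (LinearMap.ker p).subtype) hrange, ?_⟩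
  ext1 k
  obtain ⟨b, hb⟩ := hrange k
  obtain ⟨a, rfl⟩ := hq k
  have h1 : S.mkQ (w (q a)) = S.mkQ (i a) := by
    rw [← LinearMap.comp_apply, hw, hv, hu, LinearMap.comp_apply]
  rw [← hb, ← sub_eq_zero, ← map_sub, Submodule.mkQ_apply, Submodule.Quotient.mk_eq_zero,
    ← map_sub] at h1
  obtain ⟨c, hc, hcb⟩ := h1
  have h2 : q b = q a := by
    have hbca : b = c + a := by rw [hi hcb, sub_add_cancel]
    rw [hbca, map_add, show q c = 0 from hc, zero_add]
  have h3 : (LinearEquiv.ofInjective i hi).symm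
      (LinearMap.codRestrict (LinearMap.range i) (w ∘ₗ (LinearMap.ker p).subtype) hrange (q a))
      = b := by
    rw [LinearEquiv.symm_apply_eq]
    exact Subtype.ext hb.symm
  simp only [LinearMap.comp_apply, LinearEquiv.coe_coe, LinearMap.id_apply]
  rw [h3, h2]

end MemA

/-- `φ : C → M` is an `𝒜`-cover. -/
structure IsACover (G : GabrielTopology R) {C M : Type u} [AddCommGroup C] [Module R C]
    [AddCommGroup M] [Module R M] (φ : C →ₗ[R] M) : Prop where
  memA : G.MemA C
  exists_lift : ∀ (C' : Type u) [AddCommGroup C'] [Module R C'], G.MemA C' →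
    ∀ f : C' →ₗ[R] M, ∃ g : C' →ₗ[R] C, φ ∘ₗ g = f
  bijective : ∀ e : C →ₗ[R] C, φ ∘ₗ e = φ → Function.Bijective e

lemma IsACovering.exists_cover (h : G.IsACovering) (M : Type u) [AddCommGroup M] [Module R M] :
    ∃ (C : ModuleCat.{u} R) (φ : C →ₗ[R] M), G.IsACover φ := by
  obtain ⟨C, φ, h1, h2, h3⟩ := h M
  exact ⟨C, φ, h1, h2, h3⟩

namespace IsACover

variable {C M : Type u} [AddCommGroup C] [Module R C] [AddCommGroup M] [Module R M]
  {φ : C →ₗ[R] M}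

lemma surjective (h : G.IsACover φ) : Function.Surjective φ := fun m => by
  obtain ⟨g, hg⟩ := h.exists_lift R memA_of_projective (LinearMap.toSpanSingleton R M m)
  exact ⟨g 1, by rw [← LinearMap.comp_apply, hg]; simp⟩

/-- A decomposition `1 = ∑ xᵢ uᵢ` on the base of a cover lifts to an automorphism `∑ xᵢ vᵢ`. -/
lemma exists_bijective_sum (h : G.IsACover φ) {m : ℕ} (x : Fin m → R) (u : Fin m → M →ₗ[R] M)
    (hu : ∑ i, x i • u i = LinearMap.id) :
    ∃ v : Fin m → C →ₗ[R] C, Function.Bijective (∑ i, x i • v i : C →ₗ[R] C) := by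
  choose v hv using fun i => h.exists_lift C h.memA (u i ∘ₗ φ)
  refine ⟨v, h.bijective _ ?_⟩
  ext c
  have hvc : ∀ i, φ (v i c) = u i (φ c) := fun i => LinearMap.congr_fun (hv i) c
  simpa [hvc] using LinearMap.congr_fun hu (φ c)

/-- The kernel of an `𝒜`-cover is divisible. -/
lemma isDivisible_ker (hfg : G.FinitelyGenerated) (h : G.IsACover φ) :
    G.IsDivisible (LinearMap.ker φ) := by
  refine hfg.isDivisible fun m x hx β => ?_
  let S : Submodule R (C × (Fin m → R)) := Submodule.span R {((β : C), -x)}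
  have hA : G.MemA ((C × (Fin m → R)) ⧸ S) := by
    refine memA_of_exists_section fun Y _ _ p hp hk => ?_
    obtain ⟨s, hs⟩ := h.memA.exists_lift p hp hk (S.mkQ ∘ₗ LinearMap.inl R C (Fin m → R))
    choose y hy using fun i : Fin m => hp (S.mkQ (0, Pi.single i 1))
    have hkmem : s β - ∑ i, x i • y i ∈ LinearMap.ker p := by
      rw [LinearMap.mem_ker, map_sub, hs, map_sum]
      simp only [map_smul, hy]
      simp only [← map_smul, ← map_sum, LinearMap.comp_apply, ← map_sub]
      rw [Submodule.mkQ_apply, Submodule.Quotient.mk_eq_zero]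
      convert Submodule.mem_span_singleton_self ((β : C), -x) using 1
      ext j
      · simp [Prod.fst_sum]
      · simp [Prod.snd_sum, Finset.sum_apply, Pi.single_apply]
    obtain ⟨d, hd⟩ := hk.exists_sum hx ⟨_, hkmem⟩
    have hd' : s β - ∑ i, x i • y i = ∑ i, x i • (d i : Y) := by
      simpa using congrArg Subtype.val hd
    let t : (C × (Fin m → R)) →ₗ[R] Y :=
      s.coprod (Fintype.linearCombination R fun i => y i + (d i : Y))
    have ht : ∀ z, p (t z) = S.mkQ z := by
      rintro ⟨c, v⟩
      have hpd : ∀ i, p (d i) = 0 := fun i => (d i).2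
      simp only [t, LinearMap.coprod_apply, map_add, hs, Fintype.linearCombination_apply, map_sum,
        map_smul, hy, hpd, add_zero]
      simp only [← map_smul, ← map_sum, LinearMap.comp_apply, ← map_add]
      congr 1
      ext j
      · simp [Prod.fst_sum]
      · simp [Prod.snd_sum, Finset.sum_apply, Pi.single_apply]
    have ht0 : S ≤ LinearMap.ker t := by
      rw [Submodule.span_singleton_le_iff_mem, LinearMap.mem_ker]
      simp only [t, LinearMap.coprod_apply, Fintype.linearCombination_apply, Pi.neg_apply,
        neg_smul, smul_add, Finset.sum_neg_distrib, Finset.sum_add_distrib, ← hd']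
      abel
    refine ⟨S.liftQ t ht0, fun z => ?_⟩
    obtain ⟨z, rfl⟩ := S.mkQ_surjective z
    exact ht z
  have hβ : φ β = 0 := β.2
  obtain ⟨f, hf⟩ := h.exists_lift _ hA (S.liftQ (φ ∘ₗ LinearMap.fst R C (Fin m → R)) (by
    rw [Submodule.span_singleton_le_iff_mem, LinearMap.mem_ker]
    simp [hβ]))
  have hf' : ∀ z, φ (f (S.mkQ z)) = φ z.1 := fun z => by
    rw [← LinearMap.comp_apply, hf]; rfl
  let α : C →ₗ[R] C := f ∘ₗ S.mkQ ∘ₗ LinearMap.inl R C (Fin m → R)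
  have hα : ∀ c, φ (α c) = φ c := fun c => hf' (c, 0)
  have hbij := h.bijective α (LinearMap.ext hα)
  choose c hc using fun i : Fin m => hbij.2 (f (S.mkQ (0, Pi.single i 1)))
  have hc0 : ∀ i, φ (c i) = 0 := fun i => by
    rw [← hα, hc, hf', map_zero]
  refine ⟨fun i => ⟨c i, hc0 i⟩, Subtype.ext (hbij.1 ?_)⟩
  simp only [AddSubmonoidClass.coe_finsetSum, SetLike.val_smul, map_sum, map_smul, hc]
  simp only [← map_smul, ← map_sum]
  simp only [α, LinearMap.comp_apply]
  congr 1
  rw [← sub_eq_zero, ← map_sub, Submodule.mkQ_apply, Submodule.Quotient.mk_eq_zero]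
  convert Submodule.mem_span_singleton_self ((β : C), -x) using 1
  ext j
  · simp [Prod.fst_sum]
  · simp [Prod.snd_sum, Finset.sum_apply, Pi.single_apply]

end IsACover

end GabrielTopology

open Polynomial in
/-- The module `R[X] ⧸ (1 - xX)`, a localization of `R` at `x`, lies in a covering class `𝒜`. -/
lemma GabrielTopology.IsACovering.memA_away {R : Type u} [CommRing R] {G : GabrielTopology R}
    (hcov : G.IsACovering) (x : R) : G.MemA (R[X] ⧸ Ideal.span {(1 - C x * X : R[X])}) := by
  obtain ⟨I, hI⟩ : ∃ I : Ideal R[X], I = Ideal.span {(1 - C x * X : R[X])} := ⟨_, rfl⟩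
  rw [← hI]
  obtain ⟨A, φ, h⟩ := hcov.exists_cover (R[X] ⧸ I)
  have hsmul : ∀ (r : R) (q : R[X]), r • Ideal.Quotient.mk I q = Ideal.Quotient.mk I (C r * q) :=
    fun r q => by
      rw [← smul_eq_C_mul]
      exact ((Ideal.Quotient.mkₐ R I).toLinearMap.map_smul r q).symm
  have hxX : ∀ z : R[X] ⧸ I, x • (Ideal.Quotient.mk I X * z) = z := fun z => by
    obtain ⟨q, rfl⟩ := Ideal.Quotient.mk_surjective z
    rw [← map_mul, hsmul, eq_comm, Ideal.Quotient.eq, hI]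
    exact Ideal.mem_span_singleton'.2 ⟨q, by ring⟩
  obtain ⟨v, hv⟩ := h.exists_bijective_sum (m := 1) (fun _ => x)
    (fun _ => LinearMap.mulLeft R (Ideal.Quotient.mk I X)) (by
      ext1 z
      simpa using hxX z)
  have hinj : Function.Injective fun a : A => x • a := fun a b hab => hv.1 (by
    simp only [Finset.univ_unique, Finset.sum_singleton, LinearMap.smul_apply]
    rw [← map_smul, ← map_smul]
    exact congrArg _ hab)
  have hsurj : Function.Surjective fun a : A => x • a := fun a => by
    obtain ⟨b, hb⟩ := hv.2 a
    exact ⟨v 0 b, by simpa using hb⟩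
  let e : A ≃ₗ[R] A := LinearEquiv.ofBijective (LinearMap.lsmul R A x) ⟨hinj, hsurj⟩
  have he : ∀ a : A, x • e.symm a = a := fun a => e.apply_symm_apply a
  obtain ⟨a, ha⟩ := h.surjective 1
  let ev : R[X] →ₗ[R] A :=
    (LinearMap.applyₗ a) ∘ₗ (aeval (R := R) (e.symm.toLinearMap : Module.End R A)).toLinearMap
  obtain ⟨s, hs⟩ := LinearMap.exists_factor_of_surjective
    (Ideal.Quotient.mkₐ R I).toLinearMap (Ideal.Quotient.mkₐ_surjective R I) ev fun q hq => by
      have hq' : q ∈ I := Ideal.Quotient.eq_zero_iff_mem.1 hq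
      obtain ⟨r, rfl⟩ := Ideal.mem_span_singleton'.1 (hI ▸ hq')
      have : (aeval (R := R) (e.symm.toLinearMap : Module.End R A)) (1 - C x * X : R[X]) = 0 := by
        ext1 b
        simp [he, Module.algebraMap_end_apply]
      simp [ev, this]
  have hφ : ∀ q, φ (ev q) = Ideal.Quotient.mk I q := fun q => by
    induction q using Polynomial.induction_on with
    | C r =>
      simp only [ev, LinearMap.comp_apply, AlgHom.toLinearMap_apply, aeval_C,
        LinearMap.applyₗ_apply_apply, Module.algebraMap_end_apply, map_smul, ha]
      rw [← map_one (Ideal.Quotient.mk I), hsmul, mul_one]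
    | add p q hp hq => rw [map_add, map_add, map_add, hp, hq]
    | monomial n r ih =>
      have h1 : ev (C r * X ^ (n + 1)) = e.symm (ev (C r * X ^ n)) := by
        have : (C r * X ^ (n + 1) : R[X]) = X * (C r * X ^ n) := by ring
        rw [this]
        simp only [ev, LinearMap.comp_apply, AlgHom.toLinearMap_apply, map_mul (aeval _) X, aeval_X,
          LinearMap.applyₗ_apply_apply, Module.End.mul_apply, LinearEquiv.coe_coe]
      have h2 : φ (ev (C r * X ^ (n + 1))) =
          Ideal.Quotient.mk I X * (x • φ (ev (C r * X ^ (n + 1)))) := by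
        rw [mul_smul_comm, hxX]
      rw [h2, ← map_smul, h1, he, ih, ← map_mul]
      congr 1
      ring
  refine h.memA.of_retract s φ fun z => ?_
  obtain ⟨q, rfl⟩ := Ideal.Quotient.mk_surjective z
  exact (congrArg φ (hs q)).trans (hφ q)

open Polynomial in
/-- If `R[X] ⧸ (1 - xX)` lies in `𝒜`, every system `cₖ - x cₖ₊₁ = dₖ` in a divisible module is
solvable. -/
lemma GabrielTopology.IsACovering.exists_seq {R : Type u} [CommRing R] {G : GabrielTopology R}
    (hcov : G.IsACovering) (x : R) {D : Type u} [AddCommGroup D] [Module R D]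
    (hD : G.IsDivisible D) (d : ℕ → D) : ∃ c : ℕ → D, ∀ k, c k - x • c (k + 1) = d k := by
  have hM := hcov.memA_away x
  set f : R[X] := 1 - C x * X with hf
  set p : R[X] →ₗ[R] (R[X] ⧸ Ideal.span {f}) := (Ideal.Quotient.mkₐ R (Ideal.span {f})).toLinearMap
    with hp
  have hreg : f ∈ nonZeroDivisors R[X] := by
    refine mem_nonZeroDivisors_of_trailingCoeff ?_
    have h0 : f.coeff 0 = 1 := by simp [hf]
    by_cases hR : Subsingleton R
    · rw [Subsingleton.elim f.trailingCoeff 1]; exact one_mem _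
    · have : Nontrivial R := not_subsingleton_iff_nontrivial.1 hR
      have : f.natTrailingDegree = 0 := by
        rw [natTrailingDegree_eq_zero]; right; rw [h0]; exact one_ne_zero
      rw [trailingCoeff, this, h0]; exact one_mem _
  have hmem : ∀ q, p (f * q) = 0 := fun q =>
    Ideal.Quotient.eq_zero_iff_mem.2 (Ideal.mul_mem_right _ _ (Ideal.mem_span_singleton_self f))
  let m : R[X] →ₗ[R] LinearMap.ker p := LinearMap.codRestrict _ (LinearMap.mulLeft R f) hmem
  have hm : Function.Surjective m := by
    rintro ⟨q, hq⟩
    obtain ⟨r, rfl⟩ := Ideal.mem_span_singleton'.1 (Ideal.Quotient.eq_zero_iff_mem.1 hq)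
    exact ⟨r, Subtype.ext (mul_comm _ _)⟩
  obtain ⟨k, hk⟩ := LinearMap.exists_factor_of_surjective (R := R) m hm
    ((basisMonomials R).constr R d) fun q hq => by
      have : q * f = 0 := by rw [mul_comm]; exact congrArg Subtype.val hq
      rw [(mem_nonZeroDivisors_iff_right.1 hreg) q this, map_zero]
  obtain ⟨g, hg⟩ := (hM D hD).exists_extend p (Ideal.Quotient.mkₐ_surjective R _) k
  refine ⟨fun n => g (X ^ n), fun n => ?_⟩
  have h1 := (hg (m (X ^ n))).trans (hk (X ^ n))
  have h2 : (basisMonomials R).constr R d (X ^ n) = d n := by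
    rw [X_pow_eq_monomial, ← Module.Basis.constr_basis (basisMonomials R) R d n]
    simp
  rw [h2] at h1
  rw [← h1, ← map_smul, ← map_sub]
  congr 1
  change _ = f * X ^ n
  rw [smul_eq_C_mul, hf]
  ring

namespace GabrielTopology

variable {R : Type u} [CommRing R] {G : GabrielTopology R}

lemma IsACovering.exists_torsionOf_sup_mem (hfg : G.FinitelyGenerated) (hcov : G.IsACovering)
    (x : R) : ∃ n : ℕ, Ideal.torsionOf R R (x ^ n) ⊔ Ideal.span {x ^ (n + 1)} ∈ G.sets := by
  by_contra! hcon
  choose p hprime hle hp using fun n => hfg.exists_prime (hcon n)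
  let P : ℕ → Type u := fun n => Localization.AtPrime (p n)
  have hD : G.IsDivisible (Π₀ n, P n) := fun J hJ =>
    IsDivisible.dfinsupp (fun n => isDivisible_atPrime (hp n)) hJ
  obtain ⟨c, hc⟩ := hcov.exists_seq x hD fun k => DFinsupp.single k 1
  obtain ⟨m, hm⟩ := Infinite.exists_notMem_finset
    (Set.Finite.toFinset (DFinsupp.finite_support (c 0)))
  have hm0 : c 0 m = 0 := by simpa using hm
  have hstep : ∀ k ≤ m, x ^ k • c k m = 0 := fun k => by
    induction k with
    | zero => intro _; simpa using hm0
    | succ k ih =>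
      intro hk
      have h1 := DFunLike.congr_fun (hc k) m
      rw [DFinsupp.sub_apply, DFinsupp.smul_apply, DFinsupp.single_eq_of_ne (by omega),
        sub_eq_zero] at h1
      rw [pow_succ, mul_smul, ← h1]
      exact ih (by omega)
  have h1 := DFunLike.congr_fun (hc m) m
  rw [DFinsupp.sub_apply, DFinsupp.smul_apply, DFinsupp.single_eq_same, sub_eq_iff_eq_add] at h1
  have h2 := hstep m le_rfl
  rw [h1] at h2
  have hxp : x ∈ p m := (hprime m).mem_of_pow_mem (m + 1)
    (hle m (Submodule.mem_sup_right (Ideal.mem_span_singleton_self _)))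
  have hu : IsUnit ((1 : P m) + x • c (m + 1) m) := by
    have hmx : x • c (m + 1) m ∈ IsLocalRing.maximalIdeal (P m) := by
      rw [Algebra.smul_def]
      refine Ideal.mul_mem_right _ _ ?_
      exact (IsLocalization.AtPrime.to_map_mem_maximal_iff (P m) (p m) x).2 hxp
    by_contra hnu
    have := (IsLocalRing.maximalIdeal (P m)).sub_mem ((IsLocalRing.mem_maximalIdeal _).2 hnu) hmx
    rw [add_sub_cancel_right] at this
    exact (IsLocalRing.mem_maximalIdeal _).1 this isUnit_one
  rw [Algebra.smul_def, hu.mul_left_eq_zero] at h2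
  obtain ⟨s, hs⟩ := (IsLocalization.map_eq_zero_iff (p m).primeCompl (P m) _).1 h2
  exact s.2 (hle m (Submodule.mem_sup_left hs))

end GabrielTopology

namespace Ext1Vanish

variable {R : Type u} [CommRing R]

lemma of_retract {M M' D : Type u} [AddCommGroup M] [Module R M] [AddCommGroup M'] [Module R M']
    [AddCommGroup D] [Module R D] (h : Ext1Vanish R M D) (s : M' →ₗ[R] M) (r : M →ₗ[R] M')
    (hrs : ∀ m, r (s m) = m) : Ext1Vanish R M' D := by
  intro E _ _ i p hi hp hip
  obtain ⟨g, hg⟩ := h.exists_lift i p hi hp hip r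
  exact ⟨g ∘ₗ s, LinearMap.ext fun m => by simp [hg, hrs]⟩

/-- If `R → Q` is injective and `Ext¹(Q/R, D) = 0`, every element of `D` is the image of `1` under
a map `Q → D`. -/
lemma exists_map_one {Q D : Type u} [CommRing Q] [Algebra R Q] [AddCommGroup D] [Module R D]
    (h : Ext1Vanish R (cokerAlg R Q) D) (hinj : Function.Injective (algebraMap R Q)) (d : D) :
    ∃ f : Q →ₗ[R] D, f 1 = d := by
  let π : Q →ₗ[R] cokerAlg R Q := (LinearMap.range (Algebra.linearMap R Q)).mkQ
  let e : R →ₗ[R] LinearMap.ker π := LinearMap.codRestrict _ (Algebra.linearMap R Q) fun r => by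
    simp [π]
  have he : Function.Surjective e := by
    rintro ⟨q, hq⟩
    obtain ⟨r, rfl⟩ := (Submodule.Quotient.mk_eq_zero _).1 hq
    exact ⟨r, rfl⟩
  obtain ⟨k, hk⟩ := LinearMap.exists_factor_of_surjective e he (LinearMap.toSpanSingleton R D d)
    fun r hr => by
      have : r = 0 := hinj ((congrArg Subtype.val hr).trans (map_zero _).symm)
      simp [this]
  obtain ⟨g, hg⟩ := h.exists_extend π (Submodule.mkQ_surjective _) k
  refine ⟨g, ?_⟩
  have h1 := (hg (e 1)).trans (hk 1)
  have h2 : ((e 1 : LinearMap.ker π) : Q) = 1 := map_one (algebraMap R Q)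
  rw [h2] at h1
  simpa using h1

end Ext1Vanish

namespace GabrielTopology.IsRingOfQuotients

variable {R : Type u} [CommRing R] {G : GabrielTopology R} {Q : Type u} [CommRing Q] [Algebra R Q]

lemma algebraMap_injective (hf : G.Faithful) (h : G.IsRingOfQuotients Q) :
    Function.Injective (algebraMap R Q) :=
  (injective_iff_map_eq_zero _).2 fun r hr => hf r (h.ker_torsion r hr)

lemma exists_pow_smul_eq_zero (hf : G.Faithful) (hfg : G.FinitelyGenerated) (hcov : G.IsACovering)
    (h : G.IsRingOfQuotients Q) (x : R) : ∃ (n : ℕ) (q : Q), x ^ n • (1 - x • q) = 0 := by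
  obtain ⟨n, hn⟩ := hcov.exists_torsionOf_sup_mem hfg x
  refine ⟨n, ?_⟩
  set T := Ideal.torsionOf R R (x ^ n)
  set S := Ideal.span {x ^ (n + 1)}
  let g : T × R →ₗ[R] (T ⊔ S : Ideal R) :=
    (Submodule.inclusion le_sup_left).coprod (LinearMap.toSpanSingleton R (T ⊔ S : Ideal R)
      ⟨x ^ (n + 1), Submodule.mem_sup_right (Ideal.mem_span_singleton_self _)⟩)
  have hgv : ∀ z, (g z : R) = z.1 + z.2 * x ^ (n + 1) := fun z => rfl
  have hg : Function.Surjective g := by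
    rintro ⟨j, hj⟩
    obtain ⟨a, ha, s, hs, rfl⟩ := Submodule.mem_sup.1 hj
    obtain ⟨b, rfl⟩ := Ideal.mem_span_singleton'.1 hs
    exact ⟨(⟨a, ha⟩, b), Subtype.ext (hgv _)⟩
  have hT : ∀ a : T, (a : R) * x ^ n = 0 := fun a => a.2
  obtain ⟨f, hfg'⟩ := LinearMap.exists_factor_of_surjective g hg
    ((LinearMap.toSpanSingleton R Q (x ^ n • 1)) ∘ₗ LinearMap.snd R T R) (fun z hz => by
      have hz' : (z.1 : R) + z.2 * x ^ (n + 1) = 0 := by rw [← hgv, hz]; rfl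
      have h0 : z.2 * x ^ n = 0 := by
        refine hf _ (torsionOf_mem hn fun j hj => ?_)
        obtain ⟨y, hy⟩ := hg ⟨j, hj⟩
        have hjy : j = y.1 + y.2 * x ^ (n + 1) := by rw [← hgv, hy]
        have h1 := hT y.1
        have h2 := hT z.1
        rw [smul_eq_mul, hjy]
        linear_combination z.2 * h1 + y.2 * x ^ n * hz' - y.2 * h2
      simp only [LinearMap.comp_apply, LinearMap.snd_apply, LinearMap.toSpanSingleton_apply,
        smul_smul, h0, zero_smul])
  obtain ⟨q, hq⟩ := h.gInjective _ hn f
  refine ⟨q, ?_⟩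
  have h1 := (hq (g (0, 1))).symm.trans (hfg' (0, 1))
  rw [hgv] at h1
  simp only [ZeroMemClass.coe_zero, zero_add, one_mul, LinearMap.comp_apply, LinearMap.snd_apply,
    LinearMap.toSpanSingleton_apply, one_smul] at h1
  rw [smul_sub, smul_smul, ← pow_succ, h1, sub_self]

/-- If `𝒜` is covering, the ring of quotients is divisible. -/
lemma exists_sum_eq_one (hf : G.Faithful) (hfg : G.FinitelyGenerated) (hcov : G.IsACovering)
    (h : G.IsRingOfQuotients Q) {m : ℕ} {x : Fin m → R} (hx : Ideal.span (Set.range x) ∈ G.sets) :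
    ∃ c : Fin m → Q, ∑ i, x i • c i = 1 := by
  choose n q hq using fun i => h.exists_pow_smul_eq_zero hf hfg hcov (x i)
  have h0 : ∏ i, (1 - x i • q i) = 0 := by
    have hrad : Ideal.span (Set.range x) ≤
        (Ideal.torsionOf R Q (∏ i, (1 - x i • q i))).radical := by
      rw [Ideal.span_le]
      rintro _ ⟨i, rfl⟩
      refine ⟨n i, ?_⟩
      rw [Ideal.mem_torsionOf_iff, ← Finset.mul_prod_erase _ _ (Finset.mem_univ i),
        ← smul_mul_assoc, hq, zero_mul]
    obtain ⟨k, hk⟩ := Ideal.exists_pow_le_of_le_radical_of_fg hrad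
      ⟨Set.finite_range x |>.toFinset, by simp⟩
    exact h.torsionFree _ (G.mem_of_le (pow_mem hx k) hk)
  have h1 : (1 : Q) ∈ Ideal.span (Set.range fun i => algebraMap R Q (x i)) := by
    rw [← Ideal.Quotient.eq_zero_iff_mem, ← map_zero (Ideal.Quotient.mk _), ← h0, map_prod,
      map_one]
    refine (Finset.prod_eq_one fun i _ => ?_).symm
    rw [map_sub, map_one, sub_eq_self, Ideal.Quotient.eq_zero_iff_mem, Algebra.smul_def]
    exact Ideal.mul_mem_right _ _ (Ideal.subset_span ⟨i, rfl⟩)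
  obtain ⟨c, hc⟩ := Ideal.mem_span_range_iff_exists_fun.1 h1
  exact ⟨c, by rw [← hc]; simp [Algebra.smul_def, mul_comm]⟩

lemma isDivisible (hf : G.Faithful) (hfg : G.FinitelyGenerated) (hcov : G.IsACovering)
    (h : G.IsRingOfQuotients Q) : G.IsDivisible Q :=
  hfg.isDivisible fun m x hx d => by
    obtain ⟨c, hc⟩ := h.exists_sum_eq_one hf hfg hcov hx
    exact ⟨fun i => c i * d, by
      simp only [← smul_mul_assoc]
      rw [← Finset.sum_mul, hc, one_mul]⟩

/-- Each element of a torsion-free divisible module is the image of `1` under a map from the ring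
of quotients. -/
lemma exists_map_one (hf : G.Faithful) (hfg : G.FinitelyGenerated) (h : G.IsRingOfQuotients Q)
    {N : Type u} [AddCommGroup N] [Module R N] (hN : G.IsTorsionFree N) (hd : G.IsDivisible N)
    (n : N) : ∃ k : Q →ₗ[R] N, k 1 = n := by
  have hinj := h.algebraMap_injective hf
  let P : Q → N → Prop := fun q z =>
    ∃ J ∈ G.sets, ∀ j ∈ J, ∃ r : R, j • q = algebraMap R Q r ∧ j • z = r • n
  have huniq : ∀ q z z', P q z → P q z' → z = z' := by
    rintro q z z' ⟨J, hJ, hz⟩ ⟨J', hJ', hz'⟩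
    rw [← sub_eq_zero]
    refine hN _ (torsionOf_mem (G.inf_mem hJ hJ') fun j hj => ?_)
    obtain ⟨r, hr, hrz⟩ := hz j hj.1
    obtain ⟨r', hr', hrz'⟩ := hz' j hj.2
    obtain rfl := hinj (hr.symm.trans hr')
    rw [smul_sub, hrz, hrz', sub_self]
  have hex : ∀ q, ∃ z, P q z := fun q => by
    obtain ⟨J, hJ, hq⟩ := h.coker_torsion q
    obtain ⟨m, x, hxJ, hx⟩ := hfg.exists_fin hJ
    obtain ⟨c, hc⟩ := hd.exists_sum hx n
    choose r hr using fun i => hq (x i) (hxJ i)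
    refine ⟨∑ i, r i • c i, J, hJ, fun j hj => ?_⟩
    obtain ⟨s, hs⟩ := hq j hj
    refine ⟨s, hs, ?_⟩
    have hjr : ∀ i, j * r i = s * x i := fun i => hinj (by
      rw [map_mul, map_mul, ← hr, ← hs, Algebra.smul_def, Algebra.smul_def]; ring)
    rw [hc, Finset.smul_sum, Finset.smul_sum]
    exact Finset.sum_congr rfl fun i _ => by rw [smul_smul, smul_smul, hjr]
  choose k hk using hex
  refine ⟨⟨⟨k, fun q q' => ?_⟩, fun a q => ?_⟩, ?_⟩
  · refine huniq _ _ _ (hk _) ?_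
    obtain ⟨J, hJ, hz⟩ := hk q
    obtain ⟨J', hJ', hz'⟩ := hk q'
    refine ⟨_, G.inf_mem hJ hJ', fun j hj => ?_⟩
    obtain ⟨r, hr, hrz⟩ := hz j hj.1
    obtain ⟨r', hr', hrz'⟩ := hz' j hj.2
    exact ⟨r + r', by rw [smul_add, hr, hr', map_add], by rw [smul_add, hrz, hrz', add_smul]⟩
  · refine huniq _ _ _ (hk _) ?_
    obtain ⟨J, hJ, hz⟩ := hk q
    refine ⟨J, hJ, fun j hj => ?_⟩
    obtain ⟨r, hr, hrz⟩ := hz j hj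
    exact ⟨a * r, by rw [smul_comm, hr, Algebra.smul_def, map_mul],
      by rw [RingHom.id_apply, smul_comm, hrz, smul_smul]⟩
  · exact huniq _ _ _ (hk _)
      ⟨⊤, G.top_mem, fun j _ => ⟨j, by rw [Algebra.smul_def, mul_one], rfl⟩⟩

lemma map_eq_self (h : G.IsRingOfQuotients Q) (f : Q →ₗ[R] Q) (hf : f 1 = 1) (q : Q) :
    f q = q := by
  obtain ⟨J, hJ, hq⟩ := h.coker_torsion q
  rw [← sub_eq_zero]
  refine h.torsionFree _ (torsionOf_mem hJ fun j hj => ?_)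
  obtain ⟨r, hr⟩ := hq j hj
  rw [smul_sub, ← map_smul, hr, Algebra.algebraMap_eq_smul_one, map_smul, hf, sub_self]

lemma memA (hf : G.Faithful) (hfg : G.FinitelyGenerated) (hcov : G.IsACovering)
    (h : G.IsRingOfQuotients Q) : G.MemA Q := by
  obtain ⟨C, φ, hφ⟩ := hcov.exists_cover Q
  have key : ∀ {m : ℕ} {x : Fin m → R}, Ideal.span (Set.range x) ∈ G.sets →
      ∃ v : Fin m → C →ₗ[R] C, Function.Bijective (∑ i, x i • v i : C →ₗ[R] C) := by
    intro m x hx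
    obtain ⟨c, hc⟩ := h.exists_sum_eq_one hf hfg hcov hx
    refine hφ.exists_bijective_sum x (fun i => LinearMap.mulLeft R (c i)) ?_
    ext1 q
    simp only [LinearMap.sum_apply, LinearMap.smul_apply, LinearMap.mulLeft_apply,
      ← smul_mul_assoc, LinearMap.id_apply]
    rw [← Finset.sum_mul, hc, one_mul]
  have hd : G.IsDivisible C := hfg.isDivisible fun m x hx d => by
    obtain ⟨v, hv⟩ := key hx
    obtain ⟨d', rfl⟩ := hv.2 d
    exact ⟨fun i => v i d', by simp⟩
  have ht : G.IsTorsionFree C := fun c hc => by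
    obtain ⟨m, x, hxc, hx⟩ := hfg.exists_fin hc
    obtain ⟨v, hv⟩ := key hx
    refine hv.1 ?_
    have hxc' : ∀ i, x i • c = 0 := hxc
    simp [← map_smul, hxc']
  obtain ⟨c, hc⟩ := hφ.surjective 1
  obtain ⟨s, hs⟩ := h.exists_map_one hf hfg ht hd c
  exact hφ.memA.of_retract s φ (h.map_eq_self (φ ∘ₗ s) (by simp [hs, hc]))

lemma memA_cokerAlg (hf : G.Faithful) (hfg : G.FinitelyGenerated) (hcov : G.IsACovering)
    (h : G.IsRingOfQuotients Q) : G.MemA (cokerAlg R Q) := by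
  have hinj := h.algebraMap_injective hf
  obtain ⟨C, φ, hφ⟩ := hcov.exists_cover (cokerAlg R Q)
  have hB := hφ.isDivisible_ker hfg
  let π : Q →ₗ[R] cokerAlg R Q := (LinearMap.range (Algebra.linearMap R Q)).mkQ
  have hπ : Function.Surjective π := Submodule.mkQ_surjective _
  have hπ0 : ∀ q, π q = 0 ↔ ∃ r : R, algebraMap R Q r = q := fun q =>
    Submodule.Quotient.mk_eq_zero _
  obtain ⟨ψ, hψ'⟩ := hφ.exists_lift Q (h.memA hf hfg hcov) π
  have hψ : ∀ q, φ (ψ q) = π q := LinearMap.congr_fun hψ'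
  let b₀ : LinearMap.ker φ := ⟨ψ 1, (hψ 1).trans ((hπ0 1).2 ⟨1, map_one _⟩)⟩
  let P : Submodule R (C × Q) := LinearMap.ker (φ ∘ₗ LinearMap.fst R C Q - π ∘ₗ LinearMap.snd R C Q)
  have memP : ∀ z : C × Q, z ∈ P ↔ φ z.1 = π z.2 := fun z => by simp [P, sub_eq_zero]
  let p : P →ₗ[R] C := LinearMap.fst R C Q ∘ₗ P.subtype
  have hp : Function.Surjective p := fun c => by
    obtain ⟨q, hq⟩ := hπ (φ c)
    exact ⟨⟨(c, q), (memP _).2 hq.symm⟩, rfl⟩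
  have hker : ∀ z : P, p z = 0 → ∃ r : R, algebraMap R Q r = z.1.2 := fun z hz =>
    (hπ0 _).1 (by rw [← (memP z.1).1 z.2]; exact (congrArg φ hz).trans (map_zero φ))
  let ι : R →ₗ[R] P := LinearMap.codRestrict P (LinearMap.inr R C Q ∘ₗ Algebra.linearMap R Q)
    fun r => (memP _).2 ((map_zero φ).trans ((hπ0 _).2 ⟨r, rfl⟩).symm)
  have hι : ∀ z : P, p z = 0 → ∃ r, ι r = z := fun z hz => by
    obtain ⟨r, hr⟩ := hker z hz
    exact ⟨r, Subtype.ext (Prod.ext hz.symm hr)⟩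
  let ι' : R →ₗ[R] LinearMap.ker p := LinearMap.codRestrict (LinearMap.ker p) ι fun r => rfl
  have hι' : Function.Surjective ι' := by
    rintro ⟨z, hz⟩
    obtain ⟨r, hr⟩ := hι z hz
    exact ⟨r, Subtype.ext hr⟩
  have hw : ∀ b : LinearMap.ker φ, ∃ w : P →ₗ[R] LinearMap.ker φ, w (ι 1) = b := fun b => by
    obtain ⟨k, hk⟩ := LinearMap.exists_factor_of_surjective (B := LinearMap.ker p) ι' hι'
      (LinearMap.toSpanSingleton R (LinearMap.ker φ) b) fun r (hr : ι' r = 0) => by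
        have h1 : ι r = 0 := congrArg (fun z : LinearMap.ker p => z.1) hr
        have h2 : algebraMap R Q r = 0 := congrArg (fun z : P => z.1.2) h1
        rw [hinj (h2.trans (map_zero _).symm), map_zero]
    obtain ⟨g, hg⟩ := (hφ.memA _ hB).exists_extend p hp k
    exact ⟨g, ((hg (ι' 1)).trans (hk 1)).trans (by simp)⟩
  have ht : G.IsTorsionFree (LinearMap.ker φ) := fun β hβ => by
    obtain ⟨m, x, hxβ, hx⟩ := hfg.exists_fin hβ
    obtain ⟨b, hb⟩ := hB.exists_sum hx b₀
    choose w hw using fun i => hw (b i)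
    let w' : P →ₗ[R] LinearMap.ker φ := ∑ i, x i • w i
    have hw' : w' (ι 1) = b₀ := by simp [w', hw, hb]
    let e₀ : P →ₗ[R] C := ψ ∘ₗ LinearMap.snd R C Q ∘ₗ P.subtype - (LinearMap.ker φ).subtype ∘ₗ w'
    have he₀ : ∀ z, e₀ z = ψ z.1.2 - w' z := fun z => rfl
    obtain ⟨e, he⟩ := LinearMap.exists_factor_of_surjective p hp e₀ fun z hz => by
      obtain ⟨r, rfl⟩ := hι z hz
      have h1 : e₀ (ι 1) = 0 := by
        rw [he₀, hw', sub_eq_zero]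
        exact congrArg ψ (map_one (algebraMap R Q))
      rw [← mul_one r, ← smul_eq_mul, map_smul, map_smul, h1, smul_zero]
    have hbij := hφ.bijective e (LinearMap.ext fun c => by
      obtain ⟨z, rfl⟩ := hp c
      have h1 : φ (w' z) = 0 := (w' z).2
      rw [LinearMap.comp_apply, he, he₀, map_sub, h1, sub_zero, hψ]
      exact ((memP z.1).1 z.2).symm)
    have hβ0 : φ (β : C) = 0 := β.2
    let z : P := ⟨((β : C), 0), (memP _).2 (hβ0.trans (map_zero π).symm)⟩
    have hxβ' : ∀ i, x i • β = 0 := hxβ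
    have hxz : ∀ i, x i • z = 0 := fun i =>
      Subtype.ext (Prod.ext (congrArg Subtype.val (hxβ' i)) (smul_zero _))
    have hz : w' z = 0 := by simp [w', ← map_smul, hxz]
    have heβ : e (β : C) = 0 := by
      have h1 : e (p z) = ψ 0 - w' z := he z
      rw [hz, map_zero] at h1
      exact h1.trans (sub_zero _)
    exact Subtype.ext (hbij.1 (heβ.trans (map_zero e).symm))
  obtain ⟨k, hk⟩ := h.exists_map_one hf hfg ht hB b₀
  obtain ⟨s, hs⟩ := LinearMap.exists_factor_of_surjective π hπ
    (ψ - (LinearMap.ker φ).subtype ∘ₗ k) fun q hq => by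
      obtain ⟨r, rfl⟩ := (hπ0 q).1 hq
      rw [Algebra.algebraMap_eq_smul_one, map_smul]
      simp [hk, b₀]
  refine hφ.memA.of_retract s φ fun z => ?_
  obtain ⟨q, rfl⟩ := hπ z
  have h1 : φ (k q) = 0 := (k q).2
  rw [hs, LinearMap.sub_apply, map_sub, hψ]
  simp [h1]

end GabrielTopology.IsRingOfQuotients

theorem stmt7 (R : Type u) [CommRing R] (G : GabrielTopology R)
    (hG : G.IsTiltingTopology) (hcov : G.IsACovering) :
    ∀ (Q : Type u) [CommRing Q] [Algebra R Q], G.IsRingOfQuotients Q →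
      ProjDimLE1 R Q ∧
      Is1Tilting R (Q × cokerAlg R Q) ∧
      (∀ (M : Type u) [AddCommGroup M] [Module R M],
        Ext1Vanish R (Q × cokerAlg R Q) M ↔ G.IsDivisible M) ∧
      (∀ (M : Type u) [AddCommGroup M] [Module R M],
        G.IsDivisible M ↔ ∃ (ι : Type u) (f : (ι →₀ Q) →ₗ[R] M), Function.Surjective f) := by
  intro Q _ _ h
  obtain ⟨hf, hfg, -⟩ := hG
  have hinj := h.algebraMap_injective hf
  have hQd := h.isDivisible hf hfg hcov
  have hQ := h.memA hf hfg hcov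
  have hK := h.memA_cokerAlg hf hfg hcov
  have hT : G.MemA (Q × cokerAlg R Q) := hQ.prod hK
  have hTd : G.IsDivisible (Q × cokerAlg R Q) :=
    hQd.prod (hQd.of_surjective _ (Submodule.mkQ_surjective _))
  refine ⟨hQ.projDimLE1 hf hfg, ⟨hT.projDimLE1 hf hfg, fun ι => hT _ (hTd.finsupp ι), ?_⟩, ?_, ?_⟩
  · refine ⟨ModuleCat.of R Q, ModuleCat.of R (cokerAlg R Q), Algebra.linearMap R Q,
      (LinearMap.range (Algebra.linearMap R Q)).mkQ, ?_, ?_, hinj, Submodule.mkQ_surjective _,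
      (Submodule.ker_mkQ _).symm⟩
    · exact ⟨PUnit, Finsupp.lsingle PUnit.unit ∘ₗ LinearMap.inl R Q (cokerAlg R Q),
        LinearMap.fst R Q (cokerAlg R Q) ∘ₗ Finsupp.lapply PUnit.unit, by ext; simp⟩
    · exact ⟨PUnit, Finsupp.lsingle PUnit.unit ∘ₗ LinearMap.inr R Q (cokerAlg R Q),
        LinearMap.snd R Q (cokerAlg R Q) ∘ₗ Finsupp.lapply PUnit.unit,
        LinearMap.ext fun q => by simp⟩
  · intro M _ _
    refine ⟨fun hM J hJ => ?_, fun hM => hT M hM⟩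
    rw [eq_top_iff]
    rintro d -
    obtain ⟨f, rfl⟩ := (hM.of_retract (LinearMap.inr R Q (cokerAlg R Q))
      (LinearMap.snd R Q (cokerAlg R Q)) fun _ => rfl).exists_map_one hinj d
    exact hQd.map_mem f 1 hJ
  · intro M _ _
    refine ⟨fun hM => ?_, fun ⟨ι, f, hfs⟩ => (hQd.finsupp ι).of_surjective f hfs⟩
    choose f hf1 using fun d : M => (hK M hM).exists_map_one hinj d
    exact ⟨M, Finsupp.lsum R f, fun d => ⟨Finsupp.single d 1, by simp [hf1]⟩⟩
end

section
/- Let R be a commutative ring and G a faithful perfect Gabriel topology on R, with flat injective ring epimorphism u : R → U = R_G and K := U/R. Then for every R-module M, every basic open subgroup of Hom_R(K, M) in the finite topology (the annihilator of a finitely generated submodule of K) contains Hom_R(K, M)·J for some J ∈ G. Consequently ⋂_{J ∈ G} Hom_R(K, M)·J = 0, i.e. Hom_R(K, M) is G-separated, for every R-module M. -/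
universe u

open scoped TensorProduct in
/-- If `U` is flat over `R` and `R → U` is an epimorphism of rings, then the annihilator `I` of
any element of `U/R` satisfies `IU = U`. -/
theorem torsionOf_cokerAlg_smul_top {R U : Type u} [CommRing R] [CommRing U] [Algebra R U]
    [Module.Flat R U]
    (hepi : ∀ (S : Type u) [CommRing S] (f g : U →+* S),
      f.comp (algebraMap R U) = g.comp (algebraMap R U) → f = g)
    (x : cokerAlg R U) :
    Ideal.torsionOf R (cokerAlg R U) x • (⊤ : Submodule R U) = ⊤ := by
  obtain ⟨q, rfl⟩ := Submodule.Quotient.mk_surjective _ x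
  set π := (LinearMap.range (Algebra.linearMap R U)).mkQ
  set φ : R →ₗ[R] cokerAlg R U := LinearMap.toSpanSingleton R _ (π q)
  have hswap : q ⊗ₜ[R] (1 : U) = (1 : U) ⊗ₜ[R] q := by
    have h := hepi (TensorProduct R U U)
      (Algebra.TensorProduct.includeLeft (R := R) (S := R) (A := U) (B := U)).toRingHom
      (Algebra.TensorProduct.includeRight (R := R) (A := U) (B := U)).toRingHom
      (by ext r; simp)
    exact RingHom.congr_fun h q
  have hπ : π 1 = 0 := (Submodule.Quotient.mk_eq_zero _).2 ⟨1, by simp⟩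
  have hzero : ∀ v : U, φ.rTensor U (1 ⊗ₜ v) = 0 := fun v => by
    have hqv : q ⊗ₜ[R] v = (1 : U) ⊗ₜ[R] (q * v) := by
      simpa using congrArg (· * ((1 : U) ⊗ₜ[R] v)) hswap
    calc φ.rTensor U (1 ⊗ₜ v) = π.rTensor U (q ⊗ₜ v) := by simp [φ]
      _ = 0 := by rw [hqv, LinearMap.rTensor_tmul, hπ, TensorProduct.zero_tmul]
  refine eq_top_iff.2 fun v _ => ?_
  obtain ⟨t, ht⟩ :=
    (Module.Flat.rTensor_exact U (LinearMap.exact_subtype_ker_map φ) (1 ⊗ₜ v)).1 (hzero v)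
  have hmem : ∀ t : TensorProduct R (LinearMap.ker φ) U,
      TensorProduct.lid R U ((LinearMap.ker φ).subtype.rTensor U t) ∈
        Ideal.torsionOf R (cokerAlg R U) (π q) • (⊤ : Submodule R U) := fun t => by
    induction t with
    | zero => simp
    | tmul a w => exact Submodule.smul_mem_smul a.2 trivial
    | add a b ha hb => simpa only [map_add] using add_mem ha hb
  have hv := hmem t
  rwa [ht, TensorProduct.lid_tmul, one_smul] at hv

/-- The cokernel of a perfect localization is torsion. -/
theorem GabrielTopology.IsPerfectLocalization.isTorsion_cokerAlg {R U : Type u} [CommRing R]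
    [CommRing U] [Algebra R U] {G : GabrielTopology R} (h : G.IsPerfectLocalization U) :
    G.IsTorsion (cokerAlg R U) := fun x => by
  have := h.1
  exact (h.2.2 _).2 (torsionOf_cokerAlg_smul_top h.2.1 x)

/-- A finitely generated submodule of a `G`-torsion module is annihilated by an ideal in `G`. -/
theorem GabrielTopology.IsTorsion.exists_smul_eq_zero {R : Type u} [CommRing R]
    {G : GabrielTopology R} {N : Type u} [AddCommGroup N] [Module R N] (h : G.IsTorsion N)
    {X : Submodule R N} (hX : X.FG) : ∃ J ∈ G.sets, ∀ r ∈ J, ∀ x ∈ X, r • x = 0 := by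
  induction X, hX using Submodule.fg_induction with
  | singleton x =>
    refine ⟨_, h x, fun r hr y hy => ?_⟩
    obtain ⟨a, rfl⟩ := Submodule.mem_span_singleton.1 hy
    rw [smul_comm, (Ideal.mem_torsionOf_iff x r).1 hr, smul_zero]
  | sup X Y hX hY ihX ihY =>
    obtain ⟨I, hI, hIX⟩ := ihX
    obtain ⟨J, hJ, hJY⟩ := ihY
    refine ⟨I ⊓ J, G.inf_mem hI hJ, fun r hr z hz => ?_⟩
    obtain ⟨x, hx, y, hy, rfl⟩ := Submodule.mem_sup.1 hz
    rw [smul_add, hIX r hr.1 x hx, hJY r hr.2 y hy, add_zero]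

/-- If `J` annihilates `x`, then every element of `J Hom(N, M)` vanishes at `x`. -/
theorem LinearMap.apply_eq_zero_of_mem_smul_top {R N M : Type*} [CommRing R] [AddCommGroup N]
    [Module R N] [AddCommGroup M] [Module R M] {J : Ideal R} {x : N}
    (hJ : ∀ r ∈ J, r • x = 0) {f : N →ₗ[R] M} (hf : f ∈ J • (⊤ : Submodule R (N →ₗ[R] M))) :
    f x = 0 := by
  refine Submodule.smul_induction_on (p := fun g : N →ₗ[R] M => g x = 0) hf
    (fun r hr g _ => ?_) fun g g' hg hg' => ?_
  · rw [LinearMap.smul_apply, ← map_smul, hJ r hr, map_zero]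
  · rw [LinearMap.add_apply, hg, hg', add_zero]

theorem stmt10 (R : Type u) [CommRing R] (G : GabrielTopology R)
    (hfaith : G.Faithful)
    (U : Type u) [CommRing U] [Algebra R U]
    (hinj : Function.Injective (algebraMap R U))
    (hperf : G.IsPerfectLocalization U)
    (M : Type u) [AddCommGroup M] [Module R M] :
    (∀ X : Submodule R (cokerAlg R U), X.FG →
      ∃ J ∈ G.sets,
        ∀ f ∈ J • (⊤ : Submodule R (cokerAlg R U →ₗ[R] M)), ∀ x ∈ X, f x = 0) ∧
    (⨅ J ∈ G.sets, J • (⊤ : Submodule R (cokerAlg R U →ₗ[R] M))) = ⊥ := by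
  have hann : ∀ X : Submodule R (cokerAlg R U), X.FG →
      ∃ J ∈ G.sets,
        ∀ f ∈ J • (⊤ : Submodule R (cokerAlg R U →ₗ[R] M)), ∀ x ∈ X, f x = 0 := fun X hX => by
    obtain ⟨J, hJ, hJX⟩ := hperf.isTorsion_cokerAlg.exists_smul_eq_zero hX
    exact ⟨J, hJ, fun f hf x hx =>
      LinearMap.apply_eq_zero_of_mem_smul_top (fun r hr => hJX r hr x hx) hf⟩
  refine ⟨hann, (Submodule.eq_bot_iff _).2 fun f hf => LinearMap.ext fun x => ?_⟩
  obtain ⟨J, hJ, hJx⟩ := hann _ (Submodule.fg_span_singleton x)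
  simp only [Submodule.mem_iInf] at hf
  exact hJx f (hf J hJ) x (Submodule.mem_span_singleton_self x)
end

section
/- Let u : R → U be a flat injective ring epimorphism of commutative rings with associated Gabriel topology G and K := U/R. Then for every R-module M and every J ∈ G there is an isomorphism M/JM ≅ R/J ⊗_R Ext^1_R(K, M). -/
universe u

section RelativeTensor

variable {R : Type*} [CommRing R] {M E C : Type*} [AddCommGroup M] [Module R M]
  [AddCommGroup E] [Module R E] [AddCommGroup C] [Module R C]

/-- The multiplication map `J ⊗ M → M`. -/
noncomputable def idealMul (J : Ideal R) (M : Type*) [AddCommGroup M] [Module R M] :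
    TensorProduct R J M →ₗ[R] M :=
  TensorProduct.lift ((LinearMap.lsmul R M).comp J.subtype)

@[simp]
lemma idealMul_tmul (J : Ideal R) (j : J) (m : M) :
    idealMul J M (j ⊗ₜ[R] m) = (j : R) • m := rfl

lemma idealMul_lTensor (J : Ideal R) (f : M →ₗ[R] E) (t : TensorProduct R J M) :
    idealMul J E (f.lTensor J t) = f (idealMul J M t) := by
  induction t with
  | zero => simp
  | tmul j m => simp
  | add x y hx hy => simp [hx, hy]

lemma range_idealMul (J : Ideal R) :
    LinearMap.range (idealMul J M) = J • (⊤ : Submodule R M) := by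
  apply le_antisymm
  · rintro _ ⟨t, rfl⟩
    induction t with
    | zero => simp
    | tmul j m => exact Submodule.smul_mem_smul j.2 trivial
    | add x y hx hy => rw [map_add]; exact add_mem hx hy
  · rw [Submodule.smul_le]
    exact fun j hj m _ ↦ ⟨⟨j, hj⟩ ⊗ₜ m, rfl⟩

/-- If the identity of `C` is a `J`-combination of endomorphisms, then `J ⊗ C → C` is injective. -/
lemma idealMul_injective {J : Ideal R} {ι : Type*} (s : Finset ι) (j : ι → J)
    (w : ι → C →ₗ[R] C) (h : ∀ c, ∑ i ∈ s, (j i : R) • w i c = c) :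
    Function.Injective (idealMul J C) := by
  let θ : C →ₗ[R] TensorProduct R J C := ∑ i ∈ s, (TensorProduct.mk R J C (j i)).comp (w i)
  have hθ : θ.comp (idealMul J C) = LinearMap.id := by
    refine TensorProduct.ext' fun a c ↦ ?_
    have hswap (i : ι) : (a : R) • j i = (j i : R) • a := by
      exact Subtype.ext (mul_comm _ _)
    simp only [θ, LinearMap.comp_apply, idealMul_tmul, LinearMap.sum_apply, map_smul,
      TensorProduct.mk_apply, LinearMap.id_apply]
    have hc : a ⊗ₜ[R] c = ∑ i ∈ s, a ⊗ₜ[R] ((j i : R) • w i c) := by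
      rw [← TensorProduct.tmul_sum, h]
    rw [hc, Finset.smul_sum]
    refine Finset.sum_congr rfl fun i _ ↦ ?_
    rw [TensorProduct.smul_tmul', hswap, TensorProduct.smul_tmul]
  exact Function.LeftInverse.injective (g := θ) fun t ↦ LinearMap.congr_fun hθ t

/-- For an exact sequence `M → E → C → 0` such that the kernel of `M → E` lies in `JM` and the
identity of `C` is a `J`-combination of endomorphisms, `M / JM ≃ E / JE`. -/
lemma nonempty_quotient_smul_top_equiv {J : Ideal R} {f : M →ₗ[R] E} {q : E →ₗ[R] C}
    (hfq : Function.Exact f q) (hq : Function.Surjective q)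
    (hker : LinearMap.ker f ≤ J • (⊤ : Submodule R M))
    {ι : Type*} (s : Finset ι) (j : ι → J) (w : ι → C →ₗ[R] C)
    (h : ∀ c, ∑ i ∈ s, (j i : R) • w i c = c) :
    Nonempty ((M ⧸ (J • (⊤ : Submodule R M))) ≃ₗ[R] (E ⧸ (J • (⊤ : Submodule R E)))) := by
  have hcomap : J • (⊤ : Submodule R M) = (J • (⊤ : Submodule R E)).comap f := by
    apply le_antisymm
    · rw [← Submodule.map_le_iff_le_comap, Submodule.map_smul'']
      exact Submodule.smul_mono le_rfl le_top
    · intro m hm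
      rw [Submodule.mem_comap, ← range_idealMul] at hm
      obtain ⟨t, ht⟩ := hm
      have h0 : q.lTensor J t = 0 := by
        apply idealMul_injective s j w h
        rw [idealMul_lTensor, ht, hfq.apply_apply_eq_zero, map_zero]
      obtain ⟨t', rfl⟩ := (lTensor_exact J hfq hq t).1 h0
      rw [idealMul_lTensor] at ht
      have h1 : m - idealMul J M t' ∈ J • (⊤ : Submodule R M) :=
        hker (by simp [ht])
      have h2 : idealMul J M t' ∈ J • (⊤ : Submodule R M) :=
        range_idealMul (M := M) J ▸ LinearMap.mem_range_self _ t'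
      simpa using add_mem h1 h2
  let g := Submodule.mapQ _ _ f hcomap.le
  refine ⟨LinearEquiv.ofBijective g ⟨?_, ?_⟩⟩
  · rw [← LinearMap.ker_eq_bot, Submodule.ker_mapQ, ← hcomap, Submodule.mkQ_map_self]
  · rw [← LinearMap.range_eq_top, Submodule.range_mapQ, eq_top_iff]
    rintro x -
    obtain ⟨e, rfl⟩ := Submodule.mkQ_surjective _ x
    choose d hd using fun i ↦ hq (w i (q e))
    obtain ⟨m, hm⟩ := (hfq (e - ∑ i ∈ s, (j i : R) • d i)).1 (by simp [hd, h])
    refine ⟨f m, ⟨m, rfl⟩, ?_⟩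
    rw [Submodule.mkQ_apply, Submodule.mkQ_apply, Submodule.Quotient.eq, hm,
      sub_sub_cancel_left]
    exact neg_mem (sum_mem fun i _ ↦ Submodule.smul_mem_smul (j i).2 trivial)

end RelativeTensor

section Presentation

variable {R : Type*} [CommRing R] {P U M : Type*} [AddCommGroup P] [Module R P]
  [AddCommGroup M] [Module R M]

/-- Restricting linear maps to a submodule. -/
abbrev restrictHom (T : Submodule R P) (M : Type*) [AddCommGroup M] [Module R M] :
    (P →ₗ[R] M) →ₗ[R] (T →ₗ[R] M) :=
  LinearMap.lcomp R M T.subtype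

/-- The module `Ext¹(U, M)`, computed from a projective presentation `P → U`, inherits the
property that the identity is a `J`-combination of endomorphisms from the ring `U`. -/
lemma exists_endomorphisms_of_mem_smul_top [CommRing U] [Algebra R U] [Module.Projective R P]
    {J : Ideal R} (hJ : J • (⊤ : Submodule R U) = ⊤) (π : P →ₗ[R] U)
    (hπ : Function.Surjective π) :
    ∃ (s : Finset U) (j : U → J)
      (w : U → ((LinearMap.ker π →ₗ[R] M) ⧸ LinearMap.range (restrictHom (LinearMap.ker π) M))
        →ₗ[R] ((LinearMap.ker π →ₗ[R] M) ⧸ LinearMap.range (restrictHom (LinearMap.ker π) M))),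
      ∀ c, ∑ i ∈ s, (j i : R) • w i c = c := by
  have h1 : (1 : U) ∈ J • Submodule.span R (Set.range (id : U → U)) := by
    simp [hJ]
  rw [Submodule.mem_ideal_smul_span_iff_exists_sum] at h1
  obtain ⟨a, haJ, ha⟩ := h1
  choose L hL using fun v : U ↦
    Module.projective_lifting_property π ((LinearMap.mulLeft R v).comp π) hπ
  have hLπ (v : U) (x : P) : π (L v x) = v * π x := LinearMap.congr_fun (hL v) x
  have hLT (v : U) : ∀ x ∈ LinearMap.ker π, L v x ∈ LinearMap.ker π := fun x hx ↦ by
    rw [LinearMap.mem_ker] at hx ⊢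
    rw [hLπ, hx, mul_zero]
  let N := LinearMap.range (restrictHom (LinearMap.ker π) M)
  have hN (v : U) : N ≤ N.comap (LinearMap.lcomp R M ((L v).restrict (hLT v))) := by
    rintro _ ⟨g, rfl⟩
    exact ⟨g.comp (L v), rfl⟩
  refine ⟨a.support, fun v ↦ ⟨a v, haJ v⟩, fun v ↦ N.mapQ N _ (hN v), fun c ↦ ?_⟩
  obtain ⟨h, rfl⟩ := Submodule.mkQ_surjective _ c
  have hD (x : P) : ∑ v ∈ a.support, a v • L v x - x ∈ LinearMap.ker π := by
    have : ∑ v ∈ a.support, a v • v = 1 := ha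
    simp only [LinearMap.mem_ker, map_sub, map_sum, map_smul, hLπ, ← smul_mul_assoc,
      ← Finset.sum_mul, this, one_mul, sub_self]
  let D : P →ₗ[R] LinearMap.ker π :=
    (∑ v ∈ a.support, a v • L v - LinearMap.id).codRestrict _ fun x ↦ by simpa using hD x
  simp only [Submodule.mkQ_apply, Submodule.mapQ_apply, ← Submodule.Quotient.mk_smul]
  simp only [← Submodule.mkQ_apply, ← map_sum]
  rw [Submodule.mkQ_apply, Submodule.mkQ_apply, Submodule.Quotient.eq]
  refine ⟨h.comp D, LinearMap.ext fun x ↦ ?_⟩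
  have hx : D x = ∑ v ∈ a.support, a v • (L v).restrict (hLT v) x - x := by
    ext; simp [D]
  simp [hx]

end Presentation

section Connecting

variable {R : Type*} [CommRing R] {F U M : Type*} [AddCommGroup F] [Module R F]
  [AddCommGroup M] [Module R M] [CommRing U] [Algebra R U]
  {S : Submodule R F} {φ : F →ₗ[R] U} {ρ : S →ₗ[R] R}

/-- The connecting homomorphism `M → Ext¹(U / R, M)`, where `U / R` is presented as `F / S` and
`ρ : S → R` is induced by a lift `F → U` of the presentation. -/
def connecting (M : Type*) [AddCommGroup M] [Module R M] (ρ : S →ₗ[R] R) :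
    M →ₗ[R] ((S →ₗ[R] M) ⧸ LinearMap.range (restrictHom S M)) :=
  (Submodule.mkQ _).comp ((LinearMap.lcomp R M ρ).comp (LinearMap.lsmul R M).flip)

/-- The presentation `F × R → U` obtained from a lift `F → U` of a presentation of `U / R`. -/
abbrev extendedPresentation (φ : F →ₗ[R] U) : (F × R) →ₗ[R] U :=
  φ.coprod (Algebra.linearMap R U)

/-- A homomorphism vanishing under the connecting map extends along `R → U`. -/
lemma exists_extension_of_connecting_eq_zero
    (hφ : Function.Surjective (extendedPresentation φ))
    (hρ : ∀ s, algebraMap R U (ρ s) = φ s)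
    (hS : ∀ x, x ∈ S ↔ φ x ∈ LinearMap.range (Algebra.linearMap R U))
    (hinj : Function.Injective (algebraMap R U)) {m : M} (hm : connecting M ρ m = 0) :
    ∃ g : U →ₗ[R] M, g 1 = m := by
  obtain ⟨g, hg⟩ := (Submodule.Quotient.mk_eq_zero (LinearMap.range (restrictHom S M))).1 hm
  have hg' (s : S) : g s = ρ s • m := LinearMap.congr_fun hg s
  let k : (F × R) →ₗ[R] M := g.coprod (LinearMap.toSpanSingleton R M m)
  have hk : LinearMap.ker (extendedPresentation φ) ≤ LinearMap.ker k := by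
    rintro ⟨x, r⟩ hx
    have hx' : φ x + algebraMap R U r = 0 := hx
    have hxS : x ∈ S := (hS x).2 ⟨-r, by simp [eq_neg_of_add_eq_zero_left hx']⟩
    have hr : ρ ⟨x, hxS⟩ = -r := hinj (by
      rw [hρ, map_neg]; exact eq_neg_of_add_eq_zero_left hx')
    simp [k, hg' ⟨x, hxS⟩, hr]
  let e := (extendedPresentation φ).quotKerEquivOfSurjective hφ
  refine ⟨(Submodule.liftQ _ k hk).comp e.symm.toLinearMap, ?_⟩
  have he : e.symm 1 = Submodule.Quotient.mk (0, 1) := by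
    rw [LinearEquiv.symm_apply_eq]
    change (1 : U) = φ 0 + algebraMap R U 1
    simp
  simp [he, k]

/-- The tail `M → Ext¹(U / R, M) → Ext¹(U, M) → 0` of the long exact sequence. -/
lemma exists_exact_connecting
    (hρ : ∀ s, algebraMap R U (ρ s) = φ s)
    (hS : ∀ x, x ∈ S ↔ φ x ∈ LinearMap.range (Algebra.linearMap R U))
    (hinj : Function.Injective (algebraMap R U)) :
    ∃ q : ((S →ₗ[R] M) ⧸ LinearMap.range (restrictHom S M)) →ₗ[R]
        ((LinearMap.ker (extendedPresentation φ) →ₗ[R] M) ⧸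
          LinearMap.range (restrictHom (LinearMap.ker (extendedPresentation φ)) M)),
      Function.Exact (connecting M ρ) q ∧ Function.Surjective q := by
  let T := LinearMap.ker (extendedPresentation φ)
  have hT (t : T) : φ t.1.1 = -algebraMap R U t.1.2 := eq_neg_of_add_eq_zero_left t.2
  let pr : T →ₗ[R] S := ((LinearMap.fst R F R).comp T.subtype).codRestrict S fun t ↦
    (hS _).2 ⟨-t.1.2, by simp [hT t]⟩
  have hpr (t : T) : ρ (pr t) = -t.1.2 := hinj (by
    rw [hρ, map_neg]; exact hT t)
  let sec : S →ₗ[R] T := (S.subtype.prod (-ρ)).codRestrict T fun s ↦ by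
    simp [T, hρ]
  have hsec (t : T) : sec (pr t) = t := by
    refine Subtype.ext (Prod.ext rfl ?_)
    change -ρ (pr t) = _
    rw [hpr, neg_neg]
  have hmap : LinearMap.range (restrictHom S M) ≤
      (LinearMap.range (restrictHom T M)).comap (LinearMap.lcomp R M pr) := by
    rintro _ ⟨g, rfl⟩
    exact ⟨g.comp (LinearMap.fst R F R), rfl⟩
  refine ⟨Submodule.mapQ _ _ _ hmap, fun y ↦ ⟨?_, ?_⟩, fun y ↦ ?_⟩
  · obtain ⟨h, rfl⟩ := Submodule.mkQ_surjective _ y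
    intro hy
    obtain ⟨g, hg⟩ := (Submodule.Quotient.mk_eq_zero (LinearMap.range (restrictHom T M))).1 hy
    refine ⟨-g (0, 1), (Submodule.Quotient.eq (LinearMap.range (restrictHom S M))).2
      ⟨-g.comp (LinearMap.inl R F R), LinearMap.ext fun s ↦ ?_⟩⟩
    have hs : g (s, -ρ s) = h s := LinearMap.congr_fun hg (sec s)
    have hsplit : ((s : F), -ρ s) = ((s : F), (0 : R)) - ρ s • ((0 : F), (1 : R)) := by simp
    rw [hsplit, map_sub, map_smul] at hs
    simp [← hs]
    abel
  · rintro ⟨m, rfl⟩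
    refine (Submodule.Quotient.mk_eq_zero (LinearMap.range (restrictHom T M))).2
      ⟨-(LinearMap.toSpanSingleton R M m).comp (LinearMap.snd R F R), LinearMap.ext fun t ↦ ?_⟩
    simp [hpr]
  · obtain ⟨h, rfl⟩ := Submodule.mkQ_surjective _ y
    refine ⟨Submodule.Quotient.mk (h.comp sec), congrArg Submodule.Quotient.mk ?_⟩
    exact LinearMap.ext fun t ↦ congrArg h (hsec t)

end Connecting

theorem stmt13 (R : Type u) [CommRing R] (G : GabrielTopology R)
    (U : Type u) [CommRing U] [Algebra R U]
    (hinj : Function.Injective (algebraMap R U))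
    (hflat : Module.Flat R U)
    (hepi : ∀ (S : Type u) [CommRing S] (f g : U →+* S),
      f.comp (algebraMap R U) = g.comp (algebraMap R U) → f = g)
    (hGchar : ∀ J : Ideal R, J ∈ G.sets ↔ J • (⊤ : Submodule R U) = ⊤)
    (M : Type u) [AddCommGroup M] [Module R M] (J : Ideal R) (hJ : J ∈ G.sets) :
    Nonempty ((M ⧸ (J • (⊤ : Submodule R M))) ≃ₗ[R]
      TensorProduct R (R ⧸ J) (ext1 R (cokerAlg R U) M)) := by
  let S := LinearMap.ker (Finsupp.linearCombination R (id : cokerAlg R U → cokerAlg R U))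
  have hU : J • (⊤ : Submodule R U) = ⊤ := (hGchar J).1 hJ
  let mk : U →ₗ[R] cokerAlg R U := Submodule.mkQ _
  obtain ⟨φ, hφ⟩ := Module.projective_lifting_property mk
    (Finsupp.linearCombination R (id : cokerAlg R U → cokerAlg R U)) (Submodule.mkQ_surjective _)
  have hS (x : cokerAlg R U →₀ R) : x ∈ S ↔ φ x ∈ LinearMap.range (Algebra.linearMap R U) := by
    rw [← Submodule.Quotient.mk_eq_zero (LinearMap.range (Algebra.linearMap R U))]
    change _ ↔ mk.comp φ x = 0
    rw [hφ, LinearMap.mem_ker]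
  let e := LinearEquiv.ofInjective (Algebra.linearMap R U) hinj
  let ρ : S →ₗ[R] R := e.symm.toLinearMap.comp ((φ.comp S.subtype).codRestrict _ fun s ↦
    (hS s).1 s.2)
  have hρ (s : S) : algebraMap R U (ρ s) = φ s :=
    congrArg Subtype.val (e.apply_symm_apply ⟨φ s, (hS s).1 s.2⟩)
  have hsurj : Function.Surjective (extendedPresentation φ) := fun v ↦ by
    have h1 : mk (v - φ (Finsupp.single (mk v) 1)) = 0 := by
      have := LinearMap.congr_fun hφ (Finsupp.single (mk v) 1)
      rw [map_sub, ← LinearMap.comp_apply, this]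
      simp
    obtain ⟨r, hr⟩ := (Submodule.Quotient.mk_eq_zero _).1 h1
    refine ⟨(Finsupp.single (mk v) 1, r), ?_⟩
    rw [LinearMap.coprod_apply, hr, add_sub_cancel]
  obtain ⟨q, hexact, hq⟩ := exists_exact_connecting (M := M) hρ hS hinj
  obtain ⟨s, j, w, hw⟩ := exists_endomorphisms_of_mem_smul_top (M := M) hU
    (extendedPresentation φ) hsurj
  have hker : LinearMap.ker (connecting M ρ) ≤ J • (⊤ : Submodule R M) := by
    intro m hm
    obtain ⟨g, rfl⟩ := exists_extension_of_connecting_eq_zero hsurj hρ hS hinj hm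
    have h1 : (1 : U) ∈ J • (⊤ : Submodule R U) := by rw [hU]; trivial
    have h2 := Submodule.mem_map_of_mem (f := g) h1
    rw [Submodule.map_smul''] at h2
    exact Submodule.smul_mono le_rfl le_top h2
  obtain ⟨E⟩ := nonempty_quotient_smul_top_equiv hexact hq hker s j w hw
  exact ⟨E.trans (TensorProduct.quotTensorEquivQuotSMul _ J).symm⟩
end
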